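/- Let P be a II₁ factor and Q a finite separable von Neumann algebra equipped with a trace-preserving action of a countable group Γ, and assume Γ↷^σ P is an outer trace-preserving action. Consider the crossed product (P ⊗̄ Q)⋊Γ of the diagonal action. Then for any intermediate von Neumann subalgebra P⋊Γ ⊆ N ⊆ (P ⊗̄ Q)⋊Γ there is a von Neumann subalgebra Q₀ ⊆ Q such that N = (P ⊗̄ Q₀)⋊Γ. -/

import Mathlib

/-!
Common framework: we model tracial von Neumann algebras concretely, as von Neumann
algebras `M ⊆ B(H)` (Mathlib's `VonNeumannAlgebra H`, i.e. star-subalgebras equal to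
their double commutant) equipped with a faithful tracial state, and we model the
crossed product `A ⋊ Γ` of a trace-preserving action axiomatically: `M` contains a
copy of `A` and a group `(u γ)` of unitaries normalizing `A`, such that the canonical
trace-preserving conditional expectation `E_A` kills `u γ` for `γ ≠ 1`, and such that
an element of `M` all of whose Fourier coefficients `E_A (x (u γ)*)` vanish is `0`.
Probability-measure-preserving actions `Γ ↷ (X, μ)` are modelled via the associated
trace-preserving action on the abelian von Neumann algebra `A = L^∞(X)`.
-/

noncomputable section

open scoped Classical

namespace CD

/-- A group has infinite conjugacy classes (icc) if every nontrivial conjugacy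
class is infinite. -/
def IsICC (Γ : Type) [Group Γ] : Prop :=
  ∀ γ : Γ, γ ≠ 1 → {g : Γ | ∃ h : Γ, g = h * γ * h⁻¹}.Infinite

/-- A faithful tracial state on (the elements of) a set `M ⊆ B(H)` (in applications,
a von Neumann algebra), given as a globally defined linear functional whose
axioms are imposed on `M`. -/
structure TraceOn (H : Type) [NormedAddCommGroup H] [InnerProductSpace ℂ H] [CompleteSpace H]
    (M : Set (H →L[ℂ] H)) : Type where
  τ : (H →L[ℂ] H) →ₗ[ℂ] ℂ
  unital : τ 1 = 1
  tracial : ∀ x ∈ M, ∀ y ∈ M, τ (x * y) = τ (y * x)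
  star_eq : ∀ x ∈ M, τ (star x) = starRingEnd ℂ (τ x)
  nonneg : ∀ x ∈ M, 0 ≤ (τ (star x * x)).re ∧ (τ (star x * x)).im = 0
  faithful : ∀ x ∈ M, τ (star x * x) = 0 → x = 0

variable {H : Type} [NormedAddCommGroup H] [InnerProductSpace ℂ H] [CompleteSpace H]

/-- The 2-norm `‖x‖₂ = τ(x* x)^{1/2}` associated with a trace. -/
def TraceOn.norm2 {M : Set (H →L[ℂ] H)} (tr : TraceOn H M) (x : H →L[ℂ] H) : ℝ :=
  Real.sqrt (tr.τ (star x * x)).re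

/-- The (unique) trace-preserving conditional expectation from `M` onto a
von Neumann subalgebra `N ⊆ M`. -/
structure CondExpOn (H : Type) [NormedAddCommGroup H] [InnerProductSpace ℂ H] [CompleteSpace H]
    (M N : Set (H →L[ℂ] H)) (tr : TraceOn H M) : Type where
  E : (H →L[ℂ] H) →ₗ[ℂ] (H →L[ℂ] H)
  mem : ∀ x ∈ M, E x ∈ N
  fix : ∀ x ∈ N, E x = x
  bimod : ∀ a ∈ N, ∀ b ∈ N, ∀ x ∈ M, E (a * x * b) = a * E x * b
  star_map : ∀ x ∈ M, E (star x) = star (E x)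
  trace_eq : ∀ x ∈ M, tr.τ (E x) = tr.τ x
  contractive : ∀ x ∈ M, tr.norm2 (E x) ≤ tr.norm2 x

/-- The double commutant of a subset of `B(H)`: the von Neumann algebra
generated by `S` (for `S` a star-closed unital set). -/
def vnGen (S : Set (H →L[ℂ] H)) : Set (H →L[ℂ] H) :=
  Set.centralizer (Set.centralizer S)

/-- Model of the crossed product von Neumann algebra `M = A ⋊ Γ` of a
trace-preserving action `Γ ↷ (A, τ)`: `M` is generated by a copy of `A`
and canonical unitaries `(u γ)` implementing the action, with its canonical
conditional expectation `E_A` onto `A` (characterising the Fourier coefficients),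
together with the group von Neumann algebra `L(Γ) = {u γ : γ}'' ⊆ M` and the
conditional expectation onto it. -/
structure CrossedProduct (Γ : Type) [Group Γ]
    (H : Type) [NormedAddCommGroup H] [InnerProductSpace ℂ H] [CompleteSpace H] : Type where
  M : VonNeumannAlgebra H
  A : VonNeumannAlgebra H
  A_sub : (A : Set (H →L[ℂ] H)) ⊆ (M : Set (H →L[ℂ] H))
  tr : TraceOn H (M : Set (H →L[ℂ] H))
  u : Γ → (H →L[ℂ] H)
  u_mem : ∀ γ, u γ ∈ M
  u_one : u 1 = 1
  u_mul : ∀ γ δ, u γ * u δ = u (γ * δ)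
  u_star : ∀ γ, star (u γ) = u γ⁻¹
  conj_mem : ∀ (γ : Γ), ∀ a ∈ A, u γ * a * star (u γ) ∈ A
  EA : CondExpOn H (M : Set (H →L[ℂ] H)) (A : Set (H →L[ℂ] H)) tr
  EA_u : ∀ γ : Γ, γ ≠ 1 → EA.E (u γ) = 0
  fourier_sep : ∀ x ∈ M, (∀ γ : Γ, EA.E (x * star (u γ)) = 0) → x = 0
  Lg : VonNeumannAlgebra H
  Lg_eq : (Lg : Set (H →L[ℂ] H)) = vnGen (Set.range u)
  Lg_sub : (Lg : Set (H →L[ℂ] H)) ⊆ (M : Set (H →L[ℂ] H))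
  EL : CondExpOn H (M : Set (H →L[ℂ] H)) (Lg : Set (H →L[ℂ] H)) tr

variable {Γ : Type} [Group Γ]

/-- The action `σ_γ = Ad(u γ)` of `Γ` on `B(H)`, restricting to the given
action on `A`. -/
def CrossedProduct.σ (X : CrossedProduct Γ H) (γ : Γ) (x : H →L[ℂ] H) : H →L[ℂ] H :=
  X.u γ * x * star (X.u γ)

/-- The action is properly outer over the center of `P`; for abelian `P` this is
the usual freeness of the action. -/
def ProperlyOuterOn (X : CrossedProduct Γ H) (P : Set (H →L[ℂ] H)) : Prop :=
  ∀ γ : Γ, γ ≠ 1 → ∀ a ∈ P, (∀ b ∈ P, X.σ γ b * a = a * b) → a = 0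

/-- Freeness of the action `Γ ↷ A`. -/
def IsFree (X : CrossedProduct Γ H) : Prop := ProperlyOuterOn X (X.A : Set (H →L[ℂ] H))

/-- Ergodicity of the action `Γ ↷ A`: the fixed points are the scalars. -/
def IsErgodic (X : CrossedProduct Γ H) : Prop :=
  ∀ a ∈ X.A, (∀ γ : Γ, X.σ γ a = a) → ∃ c : ℂ, a = c • (1 : H →L[ℂ] H)

def IsAbelianSet (S : Set (H →L[ℂ] H)) : Prop := ∀ x ∈ S, ∀ y ∈ S, x * y = y * x

/-- `Q` is a `Γ`-invariant subset (in applications, subalgebra). -/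
def InvariantUnder (X : CrossedProduct Γ H) (Q : Set (H →L[ℂ] H)) : Prop :=
  ∀ (γ : Γ), ∀ q ∈ Q, X.σ γ q ∈ Q

/-- The intermediate crossed product `Q ⋊ Γ ⊆ A ⋊ Γ` of a (`Γ`-invariant)
subalgebra `Q ⊆ A`: those elements all of whose Fourier coefficients lie in `Q`. -/
def midCP (X : CrossedProduct Γ H) (Q : Set (H →L[ℂ] H)) : Set (H →L[ℂ] H) :=
  {x | x ∈ X.M ∧ ∀ γ : Γ, X.EA.E (x * star (X.u γ)) ∈ Q}

/-- The intermediate crossed product `A ⋊ K ⊆ A ⋊ Γ` of a subgroup `K ≤ Γ`: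
those elements whose Fourier coefficients are supported on `K`. -/
def subgpCP (X : CrossedProduct Γ H) (K : Subgroup Γ) : Set (H →L[ℂ] H) :=
  {x | x ∈ X.M ∧ ∀ γ : Γ, γ ∉ K → X.EA.E (x * star (X.u γ)) = 0}

/-- The quasinormalizer `QN_M(P)` of `P` inside `M`. -/
def QNset (M P : Set (H →L[ℂ] H)) : Set (H →L[ℂ] H) :=
  {x | x ∈ M ∧ ∃ (n : ℕ) (y : Fin n → (H →L[ℂ] H)), (∀ i, y i ∈ M) ∧
    (∀ p ∈ P, ∃ q : Fin n → (H →L[ℂ] H), (∀ i, q i ∈ P) ∧ p * x = ∑ i, y i * q i) ∧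
    (∀ p ∈ P, ∃ q : Fin n → (H →L[ℂ] H), (∀ i, q i ∈ P) ∧ x * p = ∑ i, q i * y i)}

def IsUnitaryIn (S : Set (H →L[ℂ] H)) (x : H →L[ℂ] H) : Prop :=
  x ∈ S ∧ star x * x = 1 ∧ x * star x = 1

def IsProjIn (S : Set (H →L[ℂ] H)) (p : H →L[ℂ] H) : Prop :=
  p ∈ S ∧ star p = p ∧ p * p = p

/-- The relative commutant `N' ∩ S`. -/
def commutantIn (N S : Set (H →L[ℂ] H)) : Set (H →L[ℂ] H) :=
  {x | x ∈ S ∧ ∀ y ∈ N, x * y = y * x}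

/-- Conjugation `w ( · ) w*` applied to a set. -/
def conjSet (w : H →L[ℂ] H) (S : Set (H →L[ℂ] H)) : Set (H →L[ℂ] H) :=
  (fun y => w * y * star w) '' S

/-- The scalars `ℂ 1 ⊆ B(H)`. -/
def scalars (H : Type) [NormedAddCommGroup H] [InnerProductSpace ℂ H] [CompleteSpace H] :
    Set (H →L[ℂ] H) :=
  Set.range (fun c : ℂ => c • (1 : H →L[ℂ] H))

/-- The extension `P₀ ⊆ P` of `Γ`-algebras is compact: there is a family `F ⊆ P`
with dense `‖·‖₂`-span in `P` such that the `Γ`-orbit of each `f ∈ F` can be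
uniformly approximated by finitely many "`P₀`-finite rank modules". -/
def IsCompactExt (X : CrossedProduct Γ H) (P₀ P : Set (H →L[ℂ] H)) : Prop :=
  ∃ F : Set (H →L[ℂ] H), F ⊆ P ∧
    (∀ p ∈ P, ∀ ε : ℝ, 0 < ε → ∃ (n : ℕ) (c : Fin n → ℂ) (f : Fin n → (H →L[ℂ] H)),
      (∀ i, f i ∈ F) ∧ X.tr.norm2 (p - ∑ i, c i • f i) ≤ ε) ∧
    (∀ f ∈ F, ∀ ε : ℝ, 0 < ε → ∃ (n : ℕ) (ξ : Fin n → (H →L[ℂ] H)) (C : ℝ),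
      (∀ i, ξ i ∈ P) ∧
      ∀ γ : Γ, ∃ κ : Fin n → (H →L[ℂ] H), (∀ i, κ i ∈ P₀) ∧ (∀ i, ‖κ i‖ ≤ C) ∧
        X.tr.norm2 (X.σ γ f - ∑ i, κ i * ξ i) ≤ ε)

/-- The action `Γ ↷ A` is compact: the extension over the scalars is compact. -/
def IsCompactAction (X : CrossedProduct Γ H) : Prop :=
  IsCompactExt X (scalars H) (X.A : Set (H →L[ℂ] H))

/-- The `Γ`-invariant subalgebra `B ⊆ A` gives a mixing extension: for
`t, z ∈ A ⊖ B` one has `‖E_B(t σ_γ(z))‖₂ → 0` as `γ → ∞`. -/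
def IsMixingExt (X : CrossedProduct Γ H) (B : Set (H →L[ℂ] H))
    (EB : CondExpOn H (X.M : Set (H →L[ℂ] H)) B X.tr) : Prop :=
  ∀ t ∈ X.A, ∀ z ∈ X.A, EB.E t = 0 → EB.E z = 0 →
    Filter.Tendsto (fun γ : Γ => X.tr.norm2 (EB.E (t * X.σ γ z))) Filter.cofinite (nhds 0)

/-- A `*`-isomorphism from (the von Neumann algebra with underlying set) `M ⊆ B(H₁)`
onto `N ⊆ B(H₂)`, given as a globally defined map with all axioms imposed on `M`. -/
structure StarIsoOn {H₁ : Type} [NormedAddCommGroup H₁] [InnerProductSpace ℂ H₁]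
    [CompleteSpace H₁] {H₂ : Type} [NormedAddCommGroup H₂] [InnerProductSpace ℂ H₂]
    [CompleteSpace H₂] (M : Set (H₁ →L[ℂ] H₁)) (N : Set (H₂ →L[ℂ] H₂)) : Type where
  Θ : (H₁ →L[ℂ] H₁) → (H₂ →L[ℂ] H₂)
  mem : ∀ x ∈ M, Θ x ∈ N
  map_one : Θ 1 = 1
  map_add : ∀ x ∈ M, ∀ y ∈ M, Θ (x + y) = Θ x + Θ y
  map_smul : ∀ (c : ℂ), ∀ x ∈ M, Θ (c • x) = c • Θ x
  map_mul : ∀ x ∈ M, ∀ y ∈ M, Θ (x * y) = Θ x * Θ y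
  map_star : ∀ x ∈ M, Θ (star x) = star (Θ x)
  inj : ∀ x ∈ M, ∀ y ∈ M, Θ x = Θ y → x = y
  surj : ∀ y ∈ N, ∃ x ∈ M, Θ x = y

/-- `r` is the (Pimsner–Popa/Jones) index of the inclusion `N ⊆ M`, witnessed by a
finite Pimsner–Popa basis `m₁, …, m_k` with `E_N (m_i m_j*) = δ_{ij} p_i`,
`x = ∑ᵢ E_N(x mᵢ*) mᵢ` for `x ∈ M`, and `r = ∑ᵢ τ(pᵢ)`. -/
def HasPPIndex {Mamb : Set (H →L[ℂ] H)} (tr : TraceOn H Mamb)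
    (M N : Set (H →L[ℂ] H)) (r : ℝ) : Prop :=
  ∃ E : (H →L[ℂ] H) →ₗ[ℂ] (H →L[ℂ] H),
    (∀ x ∈ M, E x ∈ N) ∧ (∀ x ∈ N, E x = x) ∧
    (∀ a ∈ N, ∀ b ∈ N, ∀ x ∈ M, E (a * x * b) = a * E x * b) ∧
    (∀ x ∈ M, tr.τ (E x) = tr.τ x) ∧
    ∃ (k : ℕ) (m p : Fin k → (H →L[ℂ] H)),
      (∀ i, m i ∈ M) ∧ (∀ i, p i ∈ N ∧ star (p i) = p i ∧ p i * p i = p i) ∧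
      (∀ i j, E (m i * star (m j)) = if i = j then p i else 0) ∧
      (∀ x ∈ M, x = ∑ i, E (x * star (m i)) * m i) ∧
      r = (∑ i, tr.τ (p i)).re

/-- The inclusion `N ⊆ M` has finite (Pimsner–Popa/Jones) index. -/
def FiniteIndexIn {Mamb : Set (H →L[ℂ] H)} (tr : TraceOn H Mamb)
    (M N : Set (H →L[ℂ] H)) : Prop :=
  ∃ r : ℝ, HasPPIndex tr M N r

/-- `S` (a von Neumann algebra) is a factor: trivial center. -/
def IsFactorSet (S : Set (H →L[ℂ] H)) : Prop :=
  ∀ x ∈ S, (∀ y ∈ S, x * y = y * x) → ∃ c : ℂ, x = c • (1 : H →L[ℂ] H)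

/-- `S` is a II₁ factor (with respect to the trace `tr`): a factor whose
projections realize every trace value in `[0,1]`. -/
def IsII1On {Mamb : Set (H →L[ℂ] H)} (tr : TraceOn H Mamb) (S : Set (H →L[ℂ] H)) : Prop :=
  IsFactorSet S ∧ ∀ r : ℝ, 0 ≤ r → r ≤ 1 →
    ∃ p ∈ S, star p = p ∧ p * p = p ∧ tr.τ p = (r : ℂ)

def IsFinDimSet (S : Set (H →L[ℂ] H)) : Prop :=
  ∃ (n : ℕ) (v : Fin n → (H →L[ℂ] H)), (∀ i, v i ∈ S) ∧
    ∀ x ∈ S, ∃ c : Fin n → ℂ, x = ∑ i, c i • v i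

def IsStarSubalgSet (S : Set (H →L[ℂ] H)) : Prop :=
  (1 : H →L[ℂ] H) ∈ S ∧ (∀ x ∈ S, ∀ y ∈ S, x + y ∈ S) ∧ (∀ x ∈ S, ∀ y ∈ S, x * y ∈ S) ∧
    (∀ (c : ℂ), ∀ x ∈ S, c • x ∈ S) ∧ (∀ x ∈ S, star x ∈ S)

/-- `S` is approximately finite dimensional (with respect to `‖·‖₂`); by Connes'
theorem this is equivalent to amenability for (separable, tracial) von Neumann
algebras. -/
def IsAFD {Mamb : Set (H →L[ℂ] H)} (tr : TraceOn H Mamb) (S : Set (H →L[ℂ] H)) : Prop :=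
  ∃ Q : ℕ → Set (H →L[ℂ] H), (∀ n, Q n ⊆ S) ∧ (∀ n, Q n ⊆ Q (n + 1)) ∧
    (∀ n, IsFinDimSet (Q n)) ∧ (∀ n, IsStarSubalgSet (Q n)) ∧
    ∀ x ∈ S, ∀ ε : ℝ, 0 < ε → ∃ n, ∃ y ∈ Q n, tr.norm2 (x - y) ≤ ε

/-- `S` is diffuse: it has no minimal projections. -/
def IsDiffuseSet (S : Set (H →L[ℂ] H)) : Prop :=
  ∀ p, IsProjIn S p → p ≠ 0 →
    ∃ q, IsProjIn S q ∧ q ≠ 0 ∧ q ≠ p ∧ q * p = q ∧ p * q = q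

/-- The (trace-preserving) action of `Γ` on the subalgebra `Q` is transitive:
`Q` is spanned by finitely many orthogonal minimal projections summing to `1`
which are permuted transitively by `Γ`. -/
def IsTransitiveOn (X : CrossedProduct Γ H) (Q : Set (H →L[ℂ] H)) : Prop :=
  ∃ (n : ℕ) (e : Fin n → (H →L[ℂ] H)),
    (∀ i, e i ∈ Q ∧ star (e i) = e i ∧ e i * e i = e i) ∧
    (∀ i j, i ≠ j → e i * e j = 0) ∧ (∑ i, e i = 1) ∧
    (∀ q ∈ Q, ∃ c : Fin n → ℂ, q = ∑ i, c i • e i) ∧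
    (∀ i j, ∃ γ : Γ, X.σ γ (e i) = e j)

/-- An abelian von Neumann algebra `S` is completely atomic: every nonzero
projection dominates a minimal projection. -/
def IsCompletelyAtomic (S : Set (H →L[ℂ] H)) : Prop :=
  ∀ p, IsProjIn S p → p ≠ 0 →
    ∃ q, IsProjIn S q ∧ q ≠ 0 ∧ q * p = q ∧
      ∀ r, IsProjIn S r → r * q = r → r = 0 ∨ r = q

end CD

namespace CD

/-- The action of `Γ` on the subalgebra `P` is outer: no `σ_γ` (for `γ ≠ 1`) is
implemented by a unitary of `P`. -/
def IsOuterOn {Γ H : Type} [Group Γ] [NormedAddCommGroup H] [InnerProductSpace ℂ H]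
    [CompleteSpace H] (X : CrossedProduct Γ H) (P : Set (H →L[ℂ] H)) : Prop :=
  ∀ γ : Γ, γ ≠ 1 → ¬ ∃ w, IsUnitaryIn P w ∧ ∀ p ∈ P, X.σ γ p = w * p * star w

/-- `S` is separable: it has a countable `‖·‖₂`-dense subset. -/
def IsSeparableSet {H : Type} [NormedAddCommGroup H] [InnerProductSpace ℂ H] [CompleteSpace H]
    {Mamb : Set (H →L[ℂ] H)} (tr : TraceOn H Mamb) (S : Set (H →L[ℂ] H)) : Prop :=
  ∃ D : Set (H →L[ℂ] H), D.Countable ∧ D ⊆ S ∧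
    ∀ x ∈ S, ∀ ε : ℝ, 0 < ε → ∃ d ∈ D, tr.norm2 (x - d) ≤ ε

end CD

set_option linter.unusedSectionVars false

namespace TG

open Filter Topology ContinuousLinearMap

section Basics

variable {H : Type} [NormedAddCommGroup H] [InnerProductSpace ℂ H] [CompleteSpace H]

/-- Ultrafilter limits of bounded families in the weak operator topology. -/
theorem ultralim {ι : Type*} (U : Ultrafilter ι) (x : ι → (H →L[ℂ] H)) (C : ℝ)
    (hx : ∀ i, ‖x i‖ ≤ C) :
    ∃ y : H →L[ℂ] H, ‖y‖ ≤ C ∧ ∀ ξ η : H,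
      Tendsto (fun i => inner ℂ η (x i ξ)) U (𝓝 (inner ℂ η (y ξ))) := by
  have hC : 0 ≤ C := by
    obtain ⟨i⟩ : Nonempty ι := U.neBot.nonempty
    exact (norm_nonneg _).trans (hx i)
  have hb : ∀ i ξ η, ‖inner ℂ (x i ξ) η‖ ≤ C * ‖ξ‖ * ‖η‖ := by
    intro i ξ η
    refine (norm_inner_le_norm _ _).trans ?_
    gcongr
    refine ((x i).le_opNorm ξ).trans ?_
    gcongr
    exact hx i
  have hl : ∀ ξ η : H, ∃ l : ℂ, ‖l‖ ≤ C * ‖ξ‖ * ‖η‖ ∧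
      Tendsto (fun i => inner ℂ (x i ξ) η) U (𝓝 l) := by
    intro ξ η
    obtain ⟨l, hl1, hl2⟩ := (isCompact_closedBall (0 : ℂ) (C * ‖ξ‖ * ‖η‖)).ultrafilter_le_nhds
      (U.map (fun i => inner ℂ (x i ξ) η)) (by
        rw [le_principal_iff]
        refine Filter.mem_map.2 (mem_of_superset univ_mem ?_)
        intro i _
        simpa using hb i ξ η)
    exact ⟨l, by simpa using hl1, hl2⟩
  choose L hL1 hL2 using hl
  let B0 : H →ₛₗ[starRingEnd ℂ] H →ₗ[ℂ] ℂ := LinearMap.mk₂'ₛₗ (starRingEnd ℂ) (RingHom.id ℂ) L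
    (by
      intro a b c
      refine tendsto_nhds_unique (hL2 _ _) ?_
      simpa [inner_add_left] using (hL2 a c).add (hL2 b c))
    (by
      intro a b c
      refine tendsto_nhds_unique (hL2 _ _) ?_
      simpa [inner_smul_left, mul_comm] using (hL2 b c).const_mul (starRingEnd ℂ a))
    (by
      intro a b c
      refine tendsto_nhds_unique (hL2 _ _) ?_
      simpa [inner_add_right] using (hL2 a b).add (hL2 a c))
    (by
      intro a b c
      refine tendsto_nhds_unique (hL2 _ _) ?_
      simpa [inner_smul_right] using (hL2 b c).const_mul a)
  let B : H →L⋆[ℂ] H →L[ℂ] ℂ := B0.mkContinuous₂ C hL1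
  have hB : ∀ ξ η, inner ℂ (InnerProductSpace.continuousLinearMapOfBilin B ξ) η = L ξ η := by
    intro ξ η
    rw [InnerProductSpace.continuousLinearMapOfBilin_apply]
    rfl
  refine ⟨InnerProductSpace.continuousLinearMapOfBilin B, ?_, ?_⟩
  · refine ContinuousLinearMap.opNorm_le_bound _ hC ?_
    intro ξ
    set w := InnerProductSpace.continuousLinearMapOfBilin B ξ
    have h1 : ‖w‖ * ‖w‖ ≤ C * ‖ξ‖ * ‖w‖ := by
      have := hL1 ξ w
      rw [← hB ξ w] at this
      have h2 : inner ℂ w w = ((‖w‖ : ℂ)) ^ 2 := inner_self_eq_norm_sq_to_K w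
      have h3 : ‖inner ℂ w w‖ = ‖w‖ * ‖w‖ := by rw [h2]; simp [sq]
      rw [← h3]
      exact this
    by_cases hw : ‖w‖ = 0
    · rw [hw]; positivity
    · exact le_of_mul_le_mul_right h1 (lt_of_le_of_ne (norm_nonneg _) (Ne.symm hw))
  · intro ξ η
    have := (hL2 ξ η)
    rw [← hB ξ η] at this
    have h2 := (Complex.continuous_conj.tendsto _).comp this
    simp only [Function.comp_def, inner_conj_symm] at h2
    exact h2

theorem mem_of_comm (M : VonNeumannAlgebra H) {x : H →L[ℂ] H}
    (h : ∀ t ∈ M.commutant, t * x = x * t) : x ∈ M := by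
  rw [← M.commutant_commutant]
  exact VonNeumannAlgebra.mem_commutant_iff.2 h

theorem comm_of_mem (M : VonNeumannAlgebra H) {x t : H →L[ℂ] H} (hx : x ∈ M)
    (ht : t ∈ M.commutant) : x * t = t * x :=
  VonNeumannAlgebra.mem_commutant_iff.1 ht x hx

theorem smul_mem' (M : VonNeumannAlgebra H) {x : H →L[ℂ] H} (c : ℂ) (hx : x ∈ M) : c • x ∈ M :=
  mem_of_comm M fun t ht => by
    rw [mul_smul_comm, smul_mul_assoc, comm_of_mem M hx ht]

theorem rsmul_mem (M : VonNeumannAlgebra H) {x : H →L[ℂ] H} (c : ℝ) (hx : x ∈ M) : c • x ∈ M :=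
  mem_of_comm M fun t ht => by
    rw [mul_smul_comm, smul_mul_assoc, comm_of_mem M hx ht]

theorem cfc_mem (M : VonNeumannAlgebra H) {x : H →L[ℂ] H} (f : ℝ → ℝ) (hx : x ∈ M) :
    cfc f x ∈ M :=
  mem_of_comm M fun t ht => by
    have h : Commute x t := comm_of_mem M hx ht
    exact (h.cfc_real f).symm

theorem exists_sqrt (M : VonNeumannAlgebra H) {x : H →L[ℂ] H} (hx : x ∈ M) (h0 : 0 ≤ x) :
    ∃ y ∈ M, 0 ≤ y ∧ star y = y ∧ y * y = x ∧ ∀ t, x * t = t * x → y * t = t * y := by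
  refine ⟨cfc Real.sqrt x, cfc_mem M _ hx, cfc_nonneg (fun t _ => Real.sqrt_nonneg t), ?_, ?_, ?_⟩
  · exact (cfc_predicate Real.sqrt x : IsSelfAdjoint _)
  · rw [← cfc_mul _ _ x (by fun_prop) (by fun_prop)]
    conv_rhs => rw [← cfc_id ℝ x h0.isSelfAdjoint]
    refine cfc_congr ?_
    intro t ht
    exact Real.mul_self_sqrt (spectrum_nonneg_of_nonneg h0 ht)
  · intro t ht
    have h : Commute x t := ht
    exact (h.cfc_real _)

theorem ultralim_mem (M : VonNeumannAlgebra H) {ι : Type*} {U : Ultrafilter ι}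
    {x : ι → (H →L[ℂ] H)} (hx : ∀ i, x i ∈ M) {y : H →L[ℂ] H}
    (hy : ∀ ξ η : H, Tendsto (fun i => inner ℂ η (x i ξ)) U (𝓝 (inner ℂ η (y ξ)))) : y ∈ M := by
  refine mem_of_comm M fun t ht => ?_
  ext ξ
  refine ext_inner_left ℂ fun η => ?_
  have h1 := hy (t ξ) η
  have h2 := hy ξ (star t η)
  have h3 : ∀ i, inner ℂ (star t η) (x i ξ) = inner ℂ η (x i (t ξ)) := by
    intro i
    rw [ContinuousLinearMap.star_eq_adjoint, ContinuousLinearMap.adjoint_inner_left]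
    have := comm_of_mem M (hx i) ht
    have := congrArg (fun z : H →L[ℂ] H => z ξ) this
    simp only [ContinuousLinearMap.mul_def, ContinuousLinearMap.comp_apply] at this
    rw [this]
  simp_rw [h3] at h2
  have h4 := tendsto_nhds_unique h1 h2
  rw [ContinuousLinearMap.star_eq_adjoint, ContinuousLinearMap.adjoint_inner_left] at h4
  simp [h4]

theorem nonneg_iff_inner {x : H →L[ℂ] H} :
    0 ≤ x ↔ ∀ ξ : H, 0 ≤ (inner ℂ ξ (x ξ)).re ∧ (inner ℂ ξ (x ξ)).im = 0 := by
  rw [ContinuousLinearMap.nonneg_iff_isPositive, ContinuousLinearMap.isPositive_iff_complex]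
  refine forall_congr' fun ξ => ?_
  rw [← inner_conj_symm ξ (x ξ)]
  generalize inner ℂ (x ξ) ξ = w
  constructor
  · rintro ⟨h1, h2⟩
    refine ⟨by simpa using h2, ?_⟩
    have := congrArg Complex.im h1
    simp at this
    simp [← this]
  · rintro ⟨h1, h2⟩
    refine ⟨?_, by simpa using h1⟩
    apply Complex.ext
    · simp
    · simp at h2
      simp [h2]

theorem ultralim_le {ι : Type*} {U : Ultrafilter ι}
    {x : ι → (H →L[ℂ] H)} {a y : H →L[ℂ] H} (hx : ∀ᶠ i in U, x i ≤ a)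
    (hy : ∀ ξ η : H, Tendsto (fun i => inner ℂ η (x i ξ)) U (𝓝 (inner ℂ η (y ξ)))) : y ≤ a := by
  rw [← sub_nonneg, nonneg_iff_inner]
  intro ξ
  have h : Tendsto (fun i => inner ℂ ξ ((a - x i) ξ)) U (𝓝 (inner ℂ ξ ((a - y) ξ))) := by
    simpa [inner_sub_right] using (hy ξ ξ).const_sub (inner ℂ ξ (a ξ))
  constructor
  · refine ge_of_tendsto ((Complex.continuous_re.tendsto _).comp h) ?_
    filter_upwards [hx] with i hi
    exact (nonneg_iff_inner.1 (sub_nonneg.2 hi) ξ).1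
  · refine tendsto_nhds_unique ((Complex.continuous_im.tendsto _).comp h) ?_
    refine tendsto_const_nhds.congr' ?_
    filter_upwards [hx] with i hi
    exact (nonneg_iff_inner.1 (sub_nonneg.2 hi) ξ).2.symm

theorem le_ultralim {ι : Type*} {U : Ultrafilter ι}
    {x : ι → (H →L[ℂ] H)} {a y : H →L[ℂ] H} (hx : ∀ᶠ i in U, a ≤ x i)
    (hy : ∀ ξ η : H, Tendsto (fun i => inner ℂ η (x i ξ)) U (𝓝 (inner ℂ η (y ξ)))) : a ≤ y := by
  have : -y ≤ -a := by
    refine ultralim_le (U := U) (x := fun i => - x i) ?_ ?_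
    · filter_upwards [hx] with i hi
      exact neg_le_neg hi
    · intro ξ η
      simpa using (hy ξ η).neg
  exact neg_le_neg_iff.1 this

theorem norm_le_one_of_nonneg_le {x : H →L[ℂ] H} (h0 : 0 ≤ x) (h1 : x ≤ 1) : ‖x‖ ≤ 1 :=
  (CStarAlgebra.norm_le_one_iff_of_nonneg x h0).2 h1

theorem conj_nonneg' {x : H →L[ℂ] H} (h0 : 0 ≤ x) (a : H →L[ℂ] H) : 0 ≤ star a * x * a :=
  star_left_conjugate_nonneg h0 a

/-- compactness of the unit ball of a von Neumann algebra corner in the weak operator topology -/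
theorem corner_ball_compact (M : VonNeumannAlgebra H) (p r : H →L[ℂ] H) :
    IsCompact {x : H →WOT[ℂ] H | x.toCLM ∈ M ∧ p * x.toCLM = x.toCLM ∧ x.toCLM * r = x.toCLM ∧
      ‖x.toCLM‖ ≤ 1} := by
  rw [isCompact_iff_ultrafilter_le_nhds]
  intro U hU
  rw [le_principal_iff] at hU
  let x : (H →WOT[ℂ] H) → (H →L[ℂ] H) := fun z => if ‖z.toCLM‖ ≤ 1 ∧ z.toCLM ∈ M ∧
    p * z.toCLM = z.toCLM ∧ z.toCLM * r = z.toCLM then z.toCLM else 0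
  have hxM : ∀ z, x z ∈ M ∧ p * x z = x z ∧ x z * r = x z ∧ ‖x z‖ ≤ 1 := by
    intro z
    by_cases h : ‖z.toCLM‖ ≤ 1 ∧ z.toCLM ∈ M ∧ p * z.toCLM = z.toCLM ∧ z.toCLM * r = z.toCLM
    · simp only [x, if_pos h]
      exact ⟨h.2.1, h.2.2.1, h.2.2.2, h.1⟩
    · simp only [x, if_neg h]
      exact ⟨zero_mem M, by simp, by simp, by simp⟩
  have hxe : ∀ᶠ z in U, x z = z.toCLM := by
    filter_upwards [hU] with z hz
    simp only [x]
    rw [if_pos ⟨hz.2.2.2, hz.1, hz.2.1, hz.2.2.1⟩]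
  obtain ⟨y, hy1, hy2⟩ := ultralim U x 1 (fun z => (hxM z).2.2.2)
  refine ⟨ContinuousLinearMapWOT.ofCLM y, ⟨ultralim_mem M (fun z => (hxM z).1) hy2, ?_, ?_, hy1⟩, ?_⟩
  · ext ξ
    refine ext_inner_left ℂ fun η => ?_
    have h1 := hy2 ξ (star p η)
    have h2 := hy2 ξ η
    have h3 : ∀ z, inner ℂ (star p η) (x z ξ) = inner ℂ η (x z ξ) := by
      intro z
      rw [ContinuousLinearMap.star_eq_adjoint, ContinuousLinearMap.adjoint_inner_left]
      conv_rhs => rw [← (hxM z).2.1]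
      rfl
    simp_rw [h3] at h1
    have h4 := tendsto_nhds_unique h1 h2
    rw [ContinuousLinearMap.star_eq_adjoint, ContinuousLinearMap.adjoint_inner_left] at h4
    exact h4
  · ext ξ
    refine ext_inner_left ℂ fun η => ?_
    have h1 := hy2 (r ξ) η
    have h2 := hy2 ξ η
    have h3 : ∀ z, inner ℂ η (x z (r ξ)) = inner ℂ η (x z ξ) := by
      intro z
      conv_rhs => rw [← (hxM z).2.2.1]
      rfl
    simp_rw [h3] at h1
    exact tendsto_nhds_unique h1 h2
  · have : Tendsto (fun z : H →WOT[ℂ] H => z) U (𝓝 (ContinuousLinearMapWOT.ofCLM y)) := by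
      rw [ContinuousLinearMapWOT.tendsto_iff_forall_inner_apply_tendsto]
      intro ξ η
      refine (hy2 ξ η).congr' ?_
      filter_upwards [hxe] with z hz
      rw [hz]
      rfl
    exact this

end Basics

end TG
namespace TG

open Filter Topology ContinuousLinearMap

section Traces

variable {H : Type} [NormedAddCommGroup H] [InnerProductSpace ℂ H] [CompleteSpace H]

/-- a faithful positive tracial functional on `M` -/
structure IsTr (M : VonNeumannAlgebra H) (φ : (H →L[ℂ] H) →ₗ[ℂ] ℂ) : Prop where
  tracial : ∀ x ∈ M, ∀ y ∈ M, φ (x * y) = φ (y * x)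
  star_eq : ∀ x ∈ M, φ (star x) = starRingEnd ℂ (φ x)
  nonneg : ∀ x ∈ M, 0 ≤ (φ (star x * x)).re
  faithful : ∀ x ∈ M, (φ (star x * x)).re = 0 → x = 0

/-- the square of the 2-norm -/
def n2 (φ : (H →L[ℂ] H) →ₗ[ℂ] ℂ) (x : H →L[ℂ] H) : ℝ := (φ (star x * x)).re

variable {M : VonNeumannAlgebra H} {φ : (H →L[ℂ] H) →ₗ[ℂ] ℂ}

theorem rsmul_re (φ : (H →L[ℂ] H) →ₗ[ℂ] ℂ) (c : ℝ) (x : H →L[ℂ] H) :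
    (φ (c • x)).re = c * (φ x).re := by
  have : c • x = (c : ℂ) • x := by ext; simp
  rw [this, map_smul]
  simp

theorem n2_smul (φ : (H →L[ℂ] H) →ₗ[ℂ] ℂ) (c : ℂ) (x : H →L[ℂ] H) :
    n2 φ (c • x) = ‖c‖ ^ 2 * n2 φ x := by
  unfold n2
  rw [star_smul, smul_mul_assoc, mul_smul_comm, smul_smul, map_smul]
  have : star c * c = ((‖c‖ ^ 2 : ℝ) : ℂ) := by
    push_cast
    exact Complex.conj_mul' c
  rw [this, smul_eq_mul, Complex.re_ofReal_mul]

theorem IsTr.im_star_mul (h : IsTr M φ) {x : H →L[ℂ] H} (hx : x ∈ M) :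
    (φ (star x * x)).im = 0 := by
  have := h.star_eq (star x * x) (mul_mem (star_mem hx) hx)
  rw [star_mul, star_star] at this
  have := congrArg Complex.im this
  simp at this
  linarith

theorem IsTr.pos (h : IsTr M φ) {x : H →L[ℂ] H} (hx : x ∈ M) (h0 : 0 ≤ x) : 0 ≤ (φ x).re := by
  obtain ⟨y, hy, -, hys, hyy, -⟩ := exists_sqrt M hx h0
  have := h.nonneg y hy
  rwa [hys, hyy] at this

theorem IsTr.im_pos (h : IsTr M φ) {x : H →L[ℂ] H} (hx : x ∈ M) (h0 : 0 ≤ x) : (φ x).im = 0 := by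
  obtain ⟨y, hy, -, hys, hyy, -⟩ := exists_sqrt M hx h0
  have := h.im_star_mul hy
  rwa [hys, hyy] at this

theorem IsTr.mono (h : IsTr M φ) {x y : H →L[ℂ] H} (hx : x ∈ M) (hy : y ∈ M) (hxy : x ≤ y) :
    (φ x).re ≤ (φ y).re := by
  have := h.pos (sub_mem hy hx) (sub_nonneg.2 hxy)
  rw [map_sub, Complex.sub_re] at this
  linarith

theorem IsTr.eq_zero (h : IsTr M φ) {x : H →L[ℂ] H} (hx : x ∈ M) (h0 : 0 ≤ x)
    (h1 : (φ x).re ≤ 0) : x = 0 := by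
  obtain ⟨y, hy, -, hys, hyy, -⟩ := exists_sqrt M hx h0
  have h2 : (φ (star y * y)).re = 0 := by
    apply le_antisymm
    · rw [hys, hyy]; exact h1
    · exact h.nonneg y hy
  rw [← hyy, h.faithful y hy h2, mul_zero]

theorem IsTr.cs (h : IsTr M φ) {x y : H →L[ℂ] H} (hx : x ∈ M) (hy : y ∈ M) :
    ‖φ (star x * y)‖ ^ 2 ≤ n2 φ x * n2 φ y := by
  let c : PreInnerProductSpace.Core ℂ M.toStarSubalgebra :=
    { inner := fun a b => φ (star (a : H →L[ℂ] H) * (b : H →L[ℂ] H))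
      conj_inner_symm := by
        intro a b
        rw [← h.star_eq _ (mul_mem (star_mem (show (b : H →L[ℂ] H) ∈ M from b.2))
          (show (a : H →L[ℂ] H) ∈ M from a.2)), star_mul, star_star]
      re_inner_nonneg := fun a => h.nonneg a a.2
      add_left := by
        intro a b c
        simp [add_mul]
      smul_left := by
        intro a b r
        simp }
  have h1 := @InnerProductSpace.Core.inner_mul_inner_self_le ℂ _ _ _ _ c
    (⟨x, hx⟩ : M.toStarSubalgebra) ⟨y, hy⟩
  have h2 : φ (star y * x) = starRingEnd ℂ (φ (star x * y)) := by
    rw [← h.star_eq _ (mul_mem (star_mem hx) hy), star_mul, star_star]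
  change ‖φ (star x * y)‖ * ‖φ (star y * x)‖ ≤ n2 φ x * n2 φ y at h1
  rw [h2, RCLike.norm_conj] at h1
  rw [sq]
  exact h1

theorem IsTr.n2_nonneg (h : IsTr M φ) {x : H →L[ℂ] H} (hx : x ∈ M) : 0 ≤ n2 φ x := h.nonneg x hx

theorem IsTr.n2_star (h : IsTr M φ) {x : H →L[ℂ] H} (hx : x ∈ M) : n2 φ (star x) = n2 φ x := by
  unfold n2
  rw [star_star, h.tracial x hx (star x) (star_mem hx)]

theorem IsTr.n2_mul_left (h : IsTr M φ) {a x : H →L[ℂ] H} (ha : a ∈ M) (hx : x ∈ M) :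
    n2 φ (a * x) ≤ ‖a‖ ^ 2 * n2 φ x := by
  unfold n2
  have h1 : star x * (star a * a) * x ≤ ‖star a * a‖ • (star x * x) :=
    CStarAlgebra.star_left_conjugate_le_norm_smul (IsSelfAdjoint.star_mul_self a)
  rw [CStarRing.norm_star_mul_self, ← sq] at h1
  have h2 := h.mono (mul_mem (mul_mem (star_mem hx) (mul_mem (star_mem ha) ha)) hx)
    (rsmul_mem M _ (mul_mem (star_mem hx) hx)) h1
  rw [rsmul_re] at h2
  rw [star_mul, show star x * star a * (a * x) = star x * (star a * a) * x by simp only [mul_assoc]]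
  exact h2

theorem IsTr.n2_mul_right (h : IsTr M φ) {a x : H →L[ℂ] H} (ha : a ∈ M) (hx : x ∈ M) :
    n2 φ (x * a) ≤ ‖a‖ ^ 2 * n2 φ x := by
  rw [← h.n2_star (mul_mem hx ha), star_mul, ← h.n2_star hx, ← norm_star a]
  exact h.n2_mul_left (star_mem ha) (star_mem hx)

theorem IsTr.n2_add_le (h : IsTr M φ) {x y : H →L[ℂ] H} (hx : x ∈ M) (hy : y ∈ M) :
    n2 φ (x + y) ≤ 2 * n2 φ x + 2 * n2 φ y := by
  have h1 := h.n2_nonneg (sub_mem hx hy)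
  have h2 : n2 φ (x + y) + n2 φ (x - y) = 2 * n2 φ x + 2 * n2 φ y := by
    unfold n2
    simp only [star_add, star_sub, add_mul, mul_add, sub_mul, mul_sub, map_add, map_sub,
      Complex.add_re, Complex.sub_re]
    ring
  linarith

theorem IsTr.n2_le (h : IsTr M φ) {x : H →L[ℂ] H} (hx : x ∈ M) :
    n2 φ x ≤ ‖x‖ ^ 2 * (φ 1).re := by
  have := h.n2_mul_left hx (one_mem M)
  simpa [n2] using this

theorem IsTr.norm_le (h : IsTr M φ) {x : H →L[ℂ] H} (hx : x ∈ M) :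
    ‖φ x‖ ≤ ‖x‖ * (φ 1).re := by
  have h1 := h.cs (one_mem M) hx
  have h2 := h.n2_le hx
  have h3 : n2 φ 1 = (φ 1).re := by simp [n2]
  have h4 : 0 ≤ (φ 1).re := by rw [← h3]; exact h.n2_nonneg (one_mem M)
  rw [star_one, one_mul, h3] at h1
  refine abs_le_of_sq_le_sq' ?_ (by positivity) |>.2
  calc ‖φ x‖ ^ 2 ≤ _ := h1
    _ ≤ (φ 1).re * (‖x‖ ^ 2 * (φ 1).re) := by gcongr
    _ = _ := by ring

theorem IsTr.n2_eq_zero (h : IsTr M φ) {x : H →L[ℂ] H} (hx : x ∈ M) (h0 : n2 φ x ≤ 0) : x = 0 :=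
  h.faithful x hx (le_antisymm h0 (h.n2_nonneg hx))

/-- an element orthogonal to everything vanishes -/
theorem IsTr.eq_zero_of_orth (h : IsTr M φ) {x : H →L[ℂ] H} (hx : x ∈ M)
    (h0 : φ (x * star x) = 0) : x = 0 := by
  have : n2 φ x ≤ 0 := by
    rw [← h.n2_star hx]
    simp [n2, h0]
  exact h.n2_eq_zero hx this

theorem IsTr.of_traceOn (tr : CD.TraceOn H (M : Set (H →L[ℂ] H))) : IsTr M tr.τ where
  tracial := tr.tracial
  star_eq := tr.star_eq
  nonneg := fun x hx => (tr.nonneg x hx).1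
  faithful := fun x hx h0 => tr.faithful x hx (Complex.ext h0 (tr.nonneg x hx).2)

end Traces

end TG
namespace TG

open Filter Topology ContinuousLinearMap

section Ideal

variable {H : Type} [NormedAddCommGroup H] [InnerProductSpace ℂ H] [CompleteSpace H]
variable {M : VonNeumannAlgebra H} {φ : (H →L[ℂ] H) →ₗ[ℂ] ℂ}

/-- orthogonal projections onto invariant subspaces -/
theorem proj_mem (M : VonNeumannAlgebra H) (K : Submodule ℂ H)
    (hK : ∀ t ∈ M.commutant, ∀ v ∈ K, t v ∈ K) :
    K.topologicalClosure.starProjection ∈ M := by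
  refine (VonNeumannAlgebra.IsStarProjection.mem_iff isStarProjection_starProjection M).2 ?_
  intro y hy
  rw [Submodule.range_starProjection]
  have hcl : ∀ v ∈ closure (K : Set H), y v ∈ closure (K : Set H) := by
    intro v hv
    exact map_mem_closure y.continuous hv (fun w hw => hK y hy w hw)
  intro v hv
  exact hcl v hv

theorem proj_star (K : Submodule ℂ H) :
    star K.topologicalClosure.starProjection = K.topologicalClosure.starProjection :=
  (isStarProjection_starProjection (U := K.topologicalClosure)).isSelfAdjoint

theorem proj_mul (K : Submodule ℂ H) :
    K.topologicalClosure.starProjection * K.topologicalClosure.starProjection =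
      K.topologicalClosure.starProjection :=
  (isStarProjection_starProjection (U := K.topologicalClosure)).isIdempotentElem

theorem proj_apply (K : Submodule ℂ H) {v : H} (hv : v ∈ K) :
    K.topologicalClosure.starProjection v = v :=
  Submodule.starProjection_eq_self_iff.2 (K.le_topologicalClosure hv)

theorem proj_eq (K : Submodule ℂ H) {a b : H →L[ℂ] H} (h : ∀ v ∈ K, a v = b v) :
    a * K.topologicalClosure.starProjection = b * K.topologicalClosure.starProjection := by
  ext w
  have h1 : ∀ v ∈ closure (K : Set H), a v = b v := by
    intro v hv
    exact (Set.EqOn.closure (fun v hv => h v hv) a.continuous b.continuous) hv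
  exact h1 _ (Submodule.starProjection_apply_mem K.topologicalClosure w)

/-- range projections -/
theorem range_proj (M : VonNeumannAlgebra H) {f : H →L[ℂ] H} (hf : f ∈ M) :
    ∃ p ∈ M, star p = p ∧ p * p = p ∧ p * f = f ∧ ∀ a b : H →L[ℂ] H, a * f = b * f → a * p = b * p := by
  let K : Submodule ℂ H := LinearMap.range f.toLinearMap
  have hK : ∀ t ∈ M.commutant, ∀ v ∈ K, t v ∈ K := by
    rintro t ht v ⟨w, rfl⟩
    refine ⟨t w, ?_⟩
    exact congrArg (fun z : H →L[ℂ] H => z w) (comm_of_mem M hf ht)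
  refine ⟨_, proj_mem M K hK, proj_star K, proj_mul K, ?_, ?_⟩
  · ext w
    exact proj_apply K ⟨w, rfl⟩
  · intro a b hab
    apply proj_eq
    rintro v ⟨w, rfl⟩
    exact congrArg (fun z : H →L[ℂ] H => z w) hab

/-- the ideal of elements `m` such that `x ↦ φ (m* x* x m)` is dominated by a vector functional -/
def JJ (M : VonNeumannAlgebra H) (φ : (H →L[ℂ] H) →ₗ[ℂ] ℂ) (m : H →L[ℂ] H) : Prop :=
  m ∈ M ∧ ∃ (ι : Type) (_ : Fintype ι) (ξ : ι → H), ∀ x ∈ M, n2 φ (x * m) ≤ ∑ i, ‖x (ξ i)‖ ^ 2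

theorem JJ.left {m a : H →L[ℂ] H} (hm : JJ M φ m) (ha : a ∈ M) : JJ M φ (a * m) := by
  obtain ⟨hm, ι, _, ξ, h⟩ := hm
  refine ⟨mul_mem ha hm, ι, inferInstance, fun i => a (ξ i), ?_⟩
  intro x hx
  rw [← mul_assoc]
  exact h (x * a) (mul_mem hx ha)

theorem JJ.right (hφ : IsTr M φ) {m a : H →L[ℂ] H} (hm : JJ M φ m) (ha : a ∈ M) :
    JJ M φ (m * a) := by
  obtain ⟨hm, ι, _, ξ, h⟩ := hm
  refine ⟨mul_mem hm ha, ι, inferInstance, fun i => (‖a‖ : ℂ) • (ξ i), ?_⟩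
  intro x hx
  rw [← mul_assoc]
  refine (hφ.n2_mul_right ha (mul_mem hx hm)).trans ?_
  refine (mul_le_mul_of_nonneg_left (h x hx) (by positivity)).trans ?_
  rw [Finset.mul_sum]
  refine Finset.sum_le_sum fun i _ => ?_
  rw [map_smul, norm_smul]
  simp [mul_pow]

theorem JJ.add (hφ : IsTr M φ) {m m' : H →L[ℂ] H} (hm : JJ M φ m) (hm' : JJ M φ m') :
    JJ M φ (m + m') := by
  obtain ⟨hm, ι, _, ξ, h⟩ := hm
  obtain ⟨hm', ι', _, ξ', h'⟩ := hm'
  refine ⟨add_mem hm hm', ι ⊕ ι', inferInstance,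
    Sum.elim (fun i => (2 : ℂ) • ξ i) (fun i => (2 : ℂ) • ξ' i), ?_⟩
  intro x hx
  rw [mul_add]
  refine (hφ.n2_add_le (mul_mem hx hm) (mul_mem hx hm')).trans ?_
  rw [Fintype.sum_sum_type]
  simp only [Sum.elim_inl, Sum.elim_inr, map_smul, norm_smul, mul_pow, ← Finset.mul_sum]
  have h1 := h x hx
  have h2 := h' x hx
  have h3 : 0 ≤ ∑ i, ‖x (ξ i)‖ ^ 2 := Finset.sum_nonneg fun i _ => by positivity
  have h4 : 0 ≤ ∑ i, ‖x (ξ' i)‖ ^ 2 := Finset.sum_nonneg fun i _ => by positivity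
  norm_num
  linarith

theorem JJ.sub (hφ : IsTr M φ) {m m' : H →L[ℂ] H} (hm : JJ M φ m) (hm' : JJ M φ m') :
    JJ M φ (m - m') := by
  have := hm.add hφ (hm'.left (neg_mem (one_mem M)))
  rwa [neg_one_mul, ← sub_eq_add_neg] at this

theorem re_inner_sub (ξ : H) (x y : H →L[ℂ] H) :
    (inner ℂ ξ ((x - y) ξ)).re = (inner ℂ ξ (x ξ)).re - (inner ℂ ξ (y ξ)).re := by
  simp

theorem exists_dominated (hφ : IsTr M φ) (hφ1 : (φ 1).re = 1) {e0 : H →L[ℂ] H} (he0 : e0 ∈ M)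
    (hs : star e0 = e0) (hi : e0 * e0 = e0) (hne : e0 ≠ 0) :
    ∃ g ∈ M, 0 ≤ g ∧ g ≤ e0 ∧ g ≠ 0 ∧ ∃ ξ : H, ∀ y ∈ M, 0 ≤ y → y ≤ g →
      (φ y).re ≤ 2 * (inner ℂ ξ (y ξ)).re := by
  have he0pos : 0 ≤ e0 := by
    have := star_mul_self_nonneg e0
    rwa [hs, hi] at this
  have he01 : e0 ≤ 1 := by
    have h := star_mul_self_nonneg (1 - e0)
    rw [star_sub, star_one, hs] at h
    have : (1 - e0) * (1 - e0) = 1 - e0 := by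
      rw [sub_mul, mul_sub, mul_sub, hi]; simp
    rw [this] at h
    exact sub_nonneg.1 h
  obtain ⟨ξ, hξ1, hξ⟩ : ∃ ξ : H, ‖ξ‖ = 1 ∧ e0 ξ = ξ := by
    obtain ⟨v, hv⟩ : ∃ v, e0 v ≠ 0 := by
      by_contra! hcon
      exact hne (by ext v; simp [hcon v])
    refine ⟨((‖e0 v‖⁻¹ : ℝ) : ℂ) • e0 v, ?_, ?_⟩
    · rw [norm_smul]
      simp [norm_ne_zero_iff.2 hv]
    · rw [map_smul]
      congr 1
      exact congrArg (fun z : H →L[ℂ] H => z v) hi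
  let ω : (H →L[ℂ] H) → ℝ := fun y => (inner ℂ ξ (y ξ)).re
  let f : (H →L[ℂ] H) → ℝ := fun y => 2 * ω y - (φ y).re
  have hωsub : ∀ x y, ω (x - y) = ω x - ω y := re_inner_sub ξ
  have hfsub : ∀ x y, f (x - y) = f x - f y := by
    intro x y
    simp only [f, hωsub, map_sub, Complex.sub_re]
    ring
  have hf0 : f 0 = 0 := by simpa using hfsub 0 0
  have hfe0 : 0 < f e0 := by
    have h1 : ω e0 = 1 := by
      simp only [ω, hξ]
      rw [inner_self_eq_norm_sq_to_K, hξ1]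
      simp
    have h2 := hφ.mono he0 (one_mem M) he01
    simp only [f, h1]
    linarith
  let α := {e : H →L[ℂ] H // e ∈ M ∧ 0 ≤ e ∧ e ≤ e0 ∧ f e ≤ 0}
  let r : α → α → Prop := fun a b => a.1 ≤ b.1 ∧ f b.1 ≤ f a.1
  have hrefl : ∀ a, r a a := fun a => ⟨le_rfl, le_rfl⟩
  have htrans : ∀ {a b c}, r a b → r b c → r a c := by
    intro a b c hab hbc
    exact ⟨hab.1.trans hbc.1, hbc.2.trans hab.2⟩
  obtain ⟨m, hm⟩ := exists_maximal_of_chains_bounded (r := r) (by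
    intro c hc
    rcases c.eq_empty_or_nonempty with rfl | ⟨a0, ha0⟩
    · exact ⟨⟨0, zero_mem M, le_rfl, he0pos, hf0.le⟩, by simp⟩
    let F : Filter c := ⨅ a : c, 𝓟 {b : c | r a.1 b.1}
    have : Nonempty c := ⟨⟨a0, ha0⟩⟩
    have hF : F.NeBot := by
      refine iInf_neBot_of_directed' ?_ ?_
      · intro a b
        have : r a.1 b.1 ∨ r b.1 a.1 := by
          by_cases hab : a.1 = b.1
          · left; rw [hab]; exact hrefl _
          · exact hc a.2 b.2 hab
        rcases this with h | h
        · refine ⟨b, ?_, le_rfl⟩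
          exact principal_mono.2 fun x hx => htrans h hx
        · refine ⟨a, le_rfl, ?_⟩
          exact principal_mono.2 fun x hx => htrans h hx
      · intro a
        exact principal_neBot_iff.2 ⟨a, hrefl _⟩
    let U : Ultrafilter c := Ultrafilter.of F
    have hU : ∀ a : c, ∀ᶠ b in (U : Filter c), r a.1 b.1 := by
      intro a
      have : (U : Filter c) ≤ 𝓟 {b : c | r a.1 b.1} :=
        (Ultrafilter.of_le F).trans (iInf_le _ a)
      exact le_principal_iff.1 this
    obtain ⟨y, -, hy⟩ := ultralim U (fun b : c => b.1.1) 1 (fun b =>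
      norm_le_one_of_nonneg_le b.1.2.2.1 (b.1.2.2.2.1.trans he01))
    have hyM : y ∈ M := ultralim_mem M (fun b => b.1.2.1) hy
    have hye : y ≤ e0 := ultralim_le (Eventually.of_forall fun b => b.1.2.2.2.1) hy
    have hy0 : 0 ≤ y := le_ultralim (Eventually.of_forall fun b => b.1.2.2.1) hy
    have hay : ∀ a : c, a.1.1 ≤ y := fun a =>
      le_ultralim ((hU a).mono fun b hb => hb.1) hy
    have hfy : ∀ a : c, f y ≤ f a.1.1 := by
      intro a
      have h1 : Tendsto (fun b : c => ω b.1.1) U (𝓝 (ω y)) :=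
        (Complex.continuous_re.tendsto _).comp (hy ξ ξ)
      have h2 : ω y ≤ (f a.1.1 + (φ y).re) / 2 := by
        refine le_of_tendsto h1 ?_
        filter_upwards [hU a] with b hb
        have h3 := hb.2
        have h4 := hφ.mono b.1.2.1 hyM (hay b)
        have h5 : f b.1.1 = 2 * ω b.1.1 - (φ b.1.1).re := rfl
        linarith
      have h5 : f y = 2 * ω y - (φ y).re := rfl
      linarith
    refine ⟨⟨y, hyM, hy0, hye, (hfy ⟨a0, ha0⟩).trans a0.2.2.2.2⟩, ?_⟩
    intro a ha
    exact ⟨hay ⟨a, ha⟩, hfy ⟨a, ha⟩⟩) htrans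
  obtain ⟨e, heM, hepos, hee0, hfe⟩ := m
  refine ⟨e0 - e, sub_mem he0 heM, sub_nonneg.2 hee0, sub_le_self _ hepos, ?_, ξ, ?_⟩
  · intro h0
    have : e0 = e := sub_eq_zero.1 h0
    rw [this] at hfe0
    linarith
  · intro y hyM hy0 hyg
    by_contra! hlt
    have hfy : f y < 0 := by
      simp only [f, ω]; linarith
    have hadd : f (e + y) = f e + f y := by
      have := hfsub (e + y) y
      rw [add_sub_cancel_right] at this
      linarith
    have h1 := (hm ⟨e + y, add_mem heM hyM, add_nonneg hepos hy0, by
      have := add_le_add_right hyg e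
      simpa using this, by rw [hadd]; linarith⟩ ⟨by simpa using hy0, by
        change f (e + y) ≤ f e
        rw [hadd]; linarith⟩).1
    have h2 : y ≤ 0 := by
      have : e + y ≤ e := h1
      simpa using this
    have h3 : y = 0 := le_antisymm h2 hy0
    rw [h3, hf0] at hfy
    exact lt_irrefl _ hfy

theorem proj_mul_of_le (M : VonNeumannAlgebra H) {g e0 : H →L[ℂ] H} (hgM : g ∈ M) (hg : 0 ≤ g) (hge : g ≤ e0) (hs : star e0 = e0)
    (hi : e0 * e0 = e0) : e0 * g = g := by
  have h1 : star (1 - e0) * g * (1 - e0) = 0 := by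
    apply le_antisymm
    · have h2 := star_left_conjugate_le_conjugate hge (1 - e0)
      have h3 : star (1 - e0) * e0 * (1 - e0) = 0 := by
        rw [star_sub, star_one, hs, sub_mul, one_mul, hi]; simp
      rwa [h3] at h2
    · exact conj_nonneg' hg _
  obtain ⟨y, -, -, hys, hyy, -⟩ := exists_sqrt M hgM hg
  have h2 : star (y * (1 - e0)) * (y * (1 - e0)) = 0 := by
    rw [star_mul, hys, ← h1, ← hyy]
    simp only [mul_assoc]
  have h3 : y * (1 - e0) = 0 := CStarRing.star_mul_self_eq_zero_iff _ |>.1 h2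
  have h4 : g * (1 - e0) = 0 := by rw [← hyy, mul_assoc, h3, mul_zero]
  have h5 := congrArg star h4
  rw [star_mul, star_zero, star_sub, star_one, hs, hg.isSelfAdjoint.star_eq, sub_mul, one_mul] at h5
  exact (sub_eq_zero.1 h5).symm

theorem exists_JJ (hφ : IsTr M φ) (hφ1 : (φ 1).re = 1) {e0 : H →L[ℂ] H} (he0 : e0 ∈ M)
    (hs : star e0 = e0) (hi : e0 * e0 = e0) (hne : e0 ≠ 0) :
    ∃ g, JJ M φ g ∧ 0 ≤ g ∧ e0 * g = g ∧ g ≠ 0 := by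
  obtain ⟨g, hgM, hg0, hge, hgne, ξ, hξ⟩ := exists_dominated hφ hφ1 he0 hs hi hne
  obtain ⟨m, hmM, hm0, hms, hmm, -⟩ := exists_sqrt M hgM hg0
  refine ⟨g, ?_, hg0, proj_mul_of_le M hgM hg0 hge hs hi, hgne⟩
  have : JJ M φ m := by
    refine ⟨hmM, Unit, inferInstance, fun _ => (2 : ℂ) • m ξ, ?_⟩
    intro x hx
    simp only [Finset.univ_unique, Finset.sum_singleton, map_smul, norm_smul]
    by_cases hx0 : x = 0
    · simp [hx0, n2]
    have hxn : 0 < ‖x‖ ^ 2 := by positivity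
    let w := star m * (star x * x) * m
    have hwM : w ∈ M := mul_mem (mul_mem (star_mem hmM) (mul_mem (star_mem hx) hx)) hmM
    have hw0 : 0 ≤ w := conj_nonneg' (star_mul_self_nonneg x) m
    have hwle : w ≤ (‖x‖ ^ 2) • g := by
      have h1 : star m * (star x * x) * m ≤ ‖star x * x‖ • (star m * m) :=
        CStarAlgebra.star_left_conjugate_le_norm_smul (IsSelfAdjoint.star_mul_self x)
      have h2 : star m * m = g := by rw [hms, hmm]
      rwa [CStarRing.norm_star_mul_self, ← sq, h2] at h1
    have h1 := hξ ((‖x‖ ^ 2)⁻¹ • w) (rsmul_mem M _ hwM) (smul_nonneg (by positivity) hw0) (by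
      have := smul_le_smul_of_nonneg_left hwle (inv_nonneg.2 hxn.le)
      rwa [smul_smul, inv_mul_cancel₀ hxn.ne', one_smul] at this)
    rw [rsmul_re] at h1
    have h2 : (inner ℂ ξ (((‖x‖ ^ 2)⁻¹ • w) ξ)).re = (‖x‖ ^ 2)⁻¹ * (inner ℂ ξ (w ξ)).re := by
      have : ((‖x‖ ^ 2)⁻¹ • w) ξ = (((‖x‖ ^ 2)⁻¹ : ℝ) : ℂ) • w ξ := by
        rw [Complex.coe_smul]; rfl
      rw [this, inner_smul_right, Complex.re_ofReal_mul]
    rw [h2] at h1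
    have h3 : (φ w).re ≤ 2 * (inner ℂ ξ (w ξ)).re := by
      have h4 : (‖x‖ ^ 2)⁻¹ * (φ w).re ≤ (‖x‖ ^ 2)⁻¹ * (2 * (inner ℂ ξ (w ξ)).re) := by linarith
      exact le_of_mul_le_mul_left h4 (by positivity)
    have h5 : (inner ℂ ξ (w ξ)).re = ‖x (m ξ)‖ ^ 2 := by
      have : w ξ = star (x * m) ((x * m) ξ) := by
        simp only [w, star_mul, mul_assoc]
        rfl
      rw [this, ContinuousLinearMap.star_eq_adjoint, ContinuousLinearMap.adjoint_inner_right,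
        inner_self_eq_norm_sq_to_K]
      norm_cast
    have h6 : n2 φ (x * m) = (φ w).re := by
      simp only [n2, star_mul, w, mul_assoc]
    rw [h6, mul_pow, ← h5]
    have : 0 ≤ (inner ℂ ξ (w ξ)).re := by rw [h5]; positivity
    norm_num
    linarith
  rw [← hmm]
  exact this.right hφ hmM

theorem exists_JJ_proj (hφ : IsTr M φ) (hφ1 : (φ 1).re = 1) {e0 : H →L[ℂ] H} (he0 : e0 ∈ M)
    (hs : star e0 = e0) (hi : e0 * e0 = e0) (hne : e0 ≠ 0) :
    ∃ p, JJ M φ p ∧ star p = p ∧ p * p = p ∧ e0 * p = p ∧ p ≠ 0 := by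
  obtain ⟨g, hgJ, hg0, heg, hgne⟩ := exists_JJ hφ hφ1 he0 hs hi hne
  have hgsa : IsSelfAdjoint g := hg0.isSelfAdjoint
  have hgn : 0 < ‖g‖ := norm_pos_iff.2 hgne
  set ε : ℝ := ‖g‖ / 2 with hε
  have hεpos : 0 < ε := by positivity
  let f := cfc (fun t : ℝ => max (t - ε) 0) g
  let k := cfc (fun t : ℝ => (max t ε)⁻¹) g
  have hkc : Continuous (fun t : ℝ => (max t ε)⁻¹) :=
    Continuous.inv₀ (by fun_prop) (fun t => (lt_of_lt_of_le hεpos (le_max_right _ _)).ne')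
  have hfM : f ∈ M := cfc_mem M _ hgJ.1
  have hkM : k ∈ M := cfc_mem M _ hgJ.1
  have hgkf : g * k * f = f := by
    have h1 : g * k * f = cfc (fun t : ℝ => id t * (max t ε)⁻¹ * max (t - ε) 0) g := by
      rw [cfc_mul _ _ g (by fun_prop) (by fun_prop), cfc_mul _ _ g (by fun_prop) hkc.continuousOn,
        cfc_id ℝ g hgsa]
    rw [h1]
    refine cfc_congr ?_
    intro t _
    simp only [id]
    rcases le_total t ε with h | h
    · rw [max_eq_right (by linarith : t - ε ≤ 0)]; simp
    · rw [max_eq_left h, mul_inv_cancel₀ (by linarith), one_mul]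
  have hfne : f ≠ 0 := by
    intro h0
    have h1 : g = cfc (fun t : ℝ => min t ε) g := by
      have h2 : g - f = cfc (fun t : ℝ => id t - max (t - ε) 0) g := by
        rw [cfc_sub _ _ g (by fun_prop) (by fun_prop), cfc_id ℝ g hgsa]
      rw [h0, sub_zero] at h2
      conv_lhs => rw [h2]
      refine cfc_congr ?_
      intro t _
      simp only [id]
      rcases le_total t ε with h | h
      · rw [max_eq_right (by linarith : t - ε ≤ 0), min_eq_left h]; simp
      · rw [max_eq_left (by linarith : 0 ≤ t - ε), min_eq_right h]; simp
    have h3 : ‖g‖ ≤ ε := by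
      rw [h1]
      refine norm_cfc_le hεpos.le ?_
      intro t ht
      have ht0 := spectrum_nonneg_of_nonneg hg0 ht
      rw [Real.norm_eq_abs, abs_of_nonneg (le_min ht0 hεpos.le)]
      exact min_le_right _ _
    linarith
  obtain ⟨p, hpM, hps, hpp, hpf, hpe⟩ := range_proj M hfM
  have h1 : g * k * p = p := by
    have := hpe (g * k) 1 (by rw [hgkf, one_mul])
    rwa [one_mul] at this
  refine ⟨p, ?_, hps, hpp, ?_, ?_⟩
  · rw [← h1, mul_assoc]
    exact hgJ.right hφ (mul_mem hkM hpM)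
  · rw [← h1, ← mul_assoc, ← mul_assoc, heg]
  · rintro rfl
    rw [zero_mul] at hpf
    exact hfne hpf.symm

end Ideal

end TG
namespace TG

open Filter Topology ContinuousLinearMap

section Central

variable {H : Type} [NormedAddCommGroup H] [InnerProductSpace ℂ H] [CompleteSpace H]
variable {M : VonNeumannAlgebra H} {φ : (H →L[ℂ] H) →ₗ[ℂ] ℂ}

theorem norm_le_one_of_star_mul_le {a : H →L[ℂ] H} (h : star a * a ≤ 1) : ‖a‖ ≤ 1 := by
  have h1 := norm_le_one_of_nonneg_le (star_mul_self_nonneg a) h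
  rw [CStarRing.norm_star_mul_self] at h1
  nlinarith [norm_nonneg a]

theorem star_mul_le_one_of_norm {a : H →L[ℂ] H} (h : ‖a‖ ≤ 1) : star a * a ≤ 1 := by
  refine (CStarAlgebra.norm_le_one_iff_of_nonneg _ (star_mul_self_nonneg a)).1 ?_
  rw [CStarRing.norm_star_mul_self]
  nlinarith [norm_nonneg a]

theorem proj_le_one {q : H →L[ℂ] H} (hs : star q = q) (hi : q * q = q) : q ≤ 1 := by
  have h := star_mul_self_nonneg (1 - q)
  rw [star_sub, star_one, hs] at h
  have : (1 - q) * (1 - q) = 1 - q := by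
    rw [sub_mul, mul_sub, mul_sub, hi]; simp
  rw [this] at h
  exact sub_nonneg.1 h

theorem proj_nonneg {q : H →L[ℂ] H} (hs : star q = q) (hi : q * q = q) : 0 ≤ q := by
  have h := star_mul_self_nonneg q
  rwa [hs, hi] at h

theorem pisom_mul {w p : H →L[ℂ] H} (hw : star w * w = p) (hps : star p = p) (hpp : p * p = p) :
    w * p = w := by
  have h : star (w - w * p) * (w - w * p) = 0 := by
    rw [star_sub, star_mul, hps, sub_mul, mul_sub, mul_sub, ← mul_assoc, hw,
      show p * star w * w = p * (star w * w) by rw [mul_assoc],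
      show p * star w * (w * p) = p * (star w * w) * p by simp only [mul_assoc], hw, hpp, hpp]
    simp
  exact (sub_eq_zero.1 ((CStarRing.star_mul_self_eq_zero_iff _).1 h)).symm

theorem exists_saturated (hφ : IsTr M φ) (hφ1 : (φ 1).re = 1) {p : H →L[ℂ] H} (hpJ : JJ M φ p)
    (hps : star p = p) (hpp : p * p = p) (hne : p ≠ 0) :
    ∃ q, JJ M φ q ∧ star q = q ∧ q * q = q ∧ ¬ ∃ w ∈ M, star w * w = p ∧ q * w = 0 := by
  by_contra! hcon
  have hpos : 0 < (φ p).re := by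
    rcases lt_or_ge 0 (φ p).re with h | h
    · exact h
    · exact absurd (hφ.eq_zero hpJ.1 (proj_nonneg hps hpp) h) hne
  have key : ∀ n : ℕ, ∃ q, JJ M φ q ∧ star q = q ∧ q * q = q ∧ n * (φ p).re ≤ (φ q).re := by
    intro n
    induction n with
    | zero =>
      refine ⟨0, ?_, by simp, by simp, by simp⟩
      have := hpJ.left (zero_mem M)
      rwa [zero_mul] at this
    | succ n ih =>
      obtain ⟨q, hqJ, hqs, hqq, hq⟩ := ih
      obtain ⟨w, hwM, hw, hqw⟩ := hcon q hqJ hqs hqq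
      have hwp := pisom_mul hw hps hpp
      have hww : w * star w * (w * star w) = w * star w := by
        rw [show w * star w * (w * star w) = w * (star w * w) * star w by simp only [mul_assoc],
          hw, hwp]
      have hwq : star w * q = 0 := by
        have := congrArg star hqw
        rwa [star_mul, hqs, star_zero] at this
      refine ⟨q + w * star w, ?_, ?_, ?_, ?_⟩
      · refine hqJ.add hφ ?_
        rw [← hwp, mul_assoc]
        refine JJ.left ?_ hwM
        refine hpJ.right hφ (star_mem (mul_mem hwM hpJ.1))
      · rw [star_add, hqs, star_mul, star_star]
      · rw [add_mul, mul_add, mul_add, hqq, hww, ← mul_assoc q w, hqw, mul_assoc w, hwq]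
        simp
      · rw [map_add, Complex.add_re, hφ.tracial w hwM (star w) (star_mem hwM), hw]
        push_cast
        linarith
  obtain ⟨n, hn⟩ := exists_nat_gt (1 / (φ p).re)
  obtain ⟨q, hqJ, hqs, hqq, hq⟩ := key n
  have h1 := hφ.mono hqJ.1 (one_mem M) (proj_le_one hqs hqq)
  rw [div_lt_iff₀ hpos] at hn
  linarith

theorem exists_extreme (M : VonNeumannAlgebra H) (p r : H →L[ℂ] H) :
    ∃ x ∈ M, p * x = x ∧ x * r = x ∧ ‖x‖ ≤ 1 ∧ ∀ y ∈ M, p * y = y → y * r = y →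
      ‖x + y‖ ≤ 1 → ‖x - y‖ ≤ 1 → y = 0 := by
  obtain ⟨x, hx⟩ := IsCompact.extremePoints_nonempty (corner_ball_compact M p r)
    ⟨0, by simp⟩
  rw [mem_extremePoints] at hx
  obtain ⟨⟨hxM, hpx, hxr, hxn⟩, hx⟩ := hx
  refine ⟨x.toCLM, hxM, hpx, hxr, hxn, ?_⟩
  intro y hyM hpy hyr h1 h2
  have := hx (ContinuousLinearMapWOT.ofCLM (x.toCLM + y))
    ⟨add_mem hxM hyM, by simp [mul_add, hpx, hpy], by simp [add_mul, hxr, hyr], h1⟩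
    (ContinuousLinearMapWOT.ofCLM (x.toCLM - y))
    ⟨sub_mem hxM hyM, by simp [mul_sub, hpx, hpy], by simp [sub_mul, hxr, hyr], h2⟩
    ⟨1 / 2, 1 / 2, by norm_num, by norm_num, by norm_num, by
      have : (1 / 2 : ℝ) • (x.toCLM + y) + (1 / 2 : ℝ) • (x.toCLM - y) = x.toCLM := by
        module
      exact congrArg ContinuousLinearMapWOT.ofCLM this⟩
  have h3 : x.toCLM + y = x.toCLM := congrArg ContinuousLinearMapWOT.toCLM this.1
  simpa using h3

theorem extreme_pisom {p r x : H →L[ℂ] H} (hxM : x ∈ M) (hpx : p * x = x) (hxr : x * r = x)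
    (hxn : ‖x‖ ≤ 1) (hx : ∀ y ∈ M, p * y = y → y * r = y →
      ‖x + y‖ ≤ 1 → ‖x - y‖ ≤ 1 → y = 0) : x * (star x * x) = x := by
  set t := star x * x with ht
  have htM : t ∈ M := mul_mem (star_mem hxM) hxM
  have hts : star t = t := by rw [ht, star_mul, star_star]
  have ht1 : t ≤ 1 := star_mul_le_one_of_norm hxn
  have ht0 : 0 ≤ t := star_mul_self_nonneg x
  have htr : t * r = t := by rw [ht, mul_assoc, hxr]
  have htn : ‖t‖ ≤ 1 := norm_le_one_of_nonneg_le ht0 ht1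
  have hy := hx ((1 / 2 : ℝ) • (x * (1 - t))) (rsmul_mem M _ (mul_mem hxM (sub_mem (one_mem M) htM)))
    (by rw [mul_smul_comm, ← mul_assoc, hpx])
    (by rw [smul_mul_assoc, mul_sub, mul_one, sub_mul, hxr, mul_assoc, htr])
    (by
      have h1 : x + (1 / 2 : ℝ) • (x * (1 - t)) = x * ((1 / 2 : ℝ) • (3 • 1 - t)) := by
        rw [mul_smul_comm, mul_sub, mul_sub, mul_one, mul_smul_comm, mul_one]
        module
      rw [h1]
      apply norm_le_one_of_star_mul_le
      rw [star_mul, show star ((1 / 2 : ℝ) • (3 • 1 - t)) = (1 / 2 : ℝ) • (3 • 1 - t) by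
        simp [hts], show (1 / 2 : ℝ) • (3 • 1 - t) * star x * (x * ((1 / 2 : ℝ) • (3 • 1 - t))) =
          (1 / 2 : ℝ) • (3 • 1 - t) * t * ((1 / 2 : ℝ) • (3 • 1 - t)) by
            rw [ht]; simp only [mul_assoc]]
      have h4 : 0 ≤ (4 : ℝ) • (1 : H →L[ℂ] H) - t := by
        have : (4 : ℝ) • (1 : H →L[ℂ] H) - t = (3 : ℝ) • (1 : H →L[ℂ] H) + (1 - t) := by module
        rw [this]
        exact add_nonneg (smul_nonneg (by norm_num) zero_le_one) (sub_nonneg.2 ht1)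
      have h5 := conj_nonneg' h4 ((1 / 2 : ℝ) • (1 - t))
      rw [show star ((1 / 2 : ℝ) • (1 - t)) = (1 / 2 : ℝ) • (1 - t) by simp [hts]] at h5
      rw [← sub_nonneg]
      convert h5 using 1
      simp only [smul_mul_assoc, mul_smul_comm, mul_sub, sub_mul, mul_one, one_mul, smul_sub,
        mul_assoc]
      module)
    (by
      have h1 : x - (1 / 2 : ℝ) • (x * (1 - t)) = x * ((1 / 2 : ℝ) • (1 + t)) := by
        rw [mul_smul_comm, mul_sub, mul_add, mul_one]
        module
      rw [h1]
      have h2 : ‖(1 / 2 : ℝ) • (1 + t)‖ ≤ 1 := by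
        rw [norm_smul]
        have h3 : ‖(1 : H →L[ℂ] H) + t‖ ≤ 2 := by
          have h4 := norm_add_le (1 : H →L[ℂ] H) t
          have h5 : ‖(1 : H →L[ℂ] H)‖ ≤ 1 := ContinuousLinearMap.norm_id_le
          linarith
        norm_num
        linarith
      refine (norm_mul_le _ _).trans ?_
      exact mul_le_one₀ hxn (norm_nonneg _) h2)
  have h2 : x * (1 - t) = 0 := by
    rcases smul_eq_zero.1 hy with h | h
    · norm_num at h
    · exact h
  rw [mul_sub, mul_one] at h2
  exact (sub_eq_zero.1 h2).symm

theorem exists_central (hφ : IsTr M φ) (hφ1 : (φ 1).re = 1) {e0 : H →L[ℂ] H} (he0 : e0 ∈ M)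
    (hs : star e0 = e0) (hi : e0 * e0 = e0) (hne : e0 ≠ 0) (he0c : ∀ m ∈ M, e0 * m = m * e0) :
    ∃ z, JJ M φ z ∧ star z = z ∧ z * z = z ∧ e0 * z = z ∧ z ≠ 0 ∧ ∀ m ∈ M, z * m = m * z := by
  obtain ⟨p, hpJ, hps, hpp, hep, hpne⟩ := exists_JJ_proj hφ hφ1 he0 hs hi hne
  obtain ⟨q, hqJ, hqs, hqq, hno⟩ := exists_saturated hφ hφ1 hpJ hps hpp hpne
  have hpM := hpJ.1
  have hqM := hqJ.1
  set r := 1 - q with hr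
  have hrs : star r = r := by rw [hr, star_sub, star_one, hqs]
  have hrr : r * r = r := by rw [hr, sub_mul, mul_sub, mul_sub, hqq]; simp
  have hrM : r ∈ M := sub_mem (one_mem M) hqM
  have hrq : r * q = 0 := by rw [hr, sub_mul, one_mul, hqq, sub_self]
  clear_value r
  obtain ⟨x, hxM, hpx, hxr, hxn, hx⟩ := exists_extreme M p r
  have hxt := extreme_pisom hxM hpx hxr hxn hx
  set t := star x * x with ht
  have htM : t ∈ M := mul_mem (star_mem hxM) hxM
  have hts : star t = t := by rw [ht, star_mul, star_star]
  have htr : t * r = t := by rw [ht, mul_assoc, hxr]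
  have hrt : r * t = t := by
    have := congrArg star htr
    rwa [star_mul, hts, hrs] at this
  have htt : t * t = t := by
    conv_lhs => rw [ht]
    rw [mul_assoc, hxt]
  have hxs : t * star x = star x := by
    have := congrArg star hxt
    rwa [star_mul, hts] at this
  set p' := p - x * star x with hp'
  set r' := r - t with hr'
  have hp'M : p' ∈ M := sub_mem hpM (mul_mem hxM (star_mem hxM))
  have hr'M : r' ∈ M := sub_mem hrM htM
  have hr's : star r' = r' := by rw [hr', star_sub, hrs, hts]
  have hrr2 : r' * r' = r' := by
    rw [hr', sub_mul, mul_sub, mul_sub, hrr, hrt, htr, htt]; simp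
  have hp's : star p' = p' := by rw [hp', star_sub, hps, star_mul, star_star]
  have hpp' : p * p' = p' := by rw [hp', mul_sub, hpp, ← mul_assoc, hpx]
  have hr'r : r' * r = r' := by rw [hr', sub_mul, hrr, htr]
  have hxp' : star x * p' = 0 := by
    have h1 : star x * p = star x := by
      have := congrArg star hpx
      rwa [star_mul, hps] at this
    rw [hp', mul_sub, h1, ← mul_assoc, ← ht, hxs, sub_self]
  have hzero1 : ∀ m ∈ M, ‖p' * m * r'‖ ≤ 1 → p' * m * r' = 0 := by
    intro m hm hn
    set y := p' * m * r' with hy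
    have hyM : y ∈ M := mul_mem (mul_mem hp'M hm) hr'M
    have hpy : p * y = y := by rw [hy, ← mul_assoc, ← mul_assoc, hpp']
    have hyr : y * r = y := by rw [hy, mul_assoc, hr'r]
    have hxy : star x * y = 0 := by rw [hy, ← mul_assoc, ← mul_assoc, hxp']; simp
    have hyx : star y * x = 0 := by
      have := congrArg star hxy
      rwa [star_mul, star_star, star_zero] at this
    have hyr' : y * r' = y := by rw [hy, mul_assoc, hrr2]
    have hry : r' * star y = star y := by
      have := congrArg star hyr'
      rwa [star_mul, hr's] at this
    have hyy : star y * y ≤ r' := by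
      have h1 : star r' * (star y * y) * r' ≤ ‖star y * y‖ • (star r' * r') :=
        CStarAlgebra.star_left_conjugate_le_norm_smul (IsSelfAdjoint.star_mul_self y)
      rw [hr's, hrr2, ← mul_assoc, hry, mul_assoc, hyr'] at h1
      refine h1.trans ?_
      have h2 : ‖star y * y‖ ≤ 1 := by
        rw [CStarRing.norm_star_mul_self]
        exact mul_le_one₀ hn (norm_nonneg _) hn
      have h3 : ‖star y * y‖ • r' ≤ (1 : ℝ) • r' :=
        smul_le_smul_of_nonneg_right h2 (proj_nonneg hr's hrr2)
      rwa [one_smul] at h3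
    have hsum : t + star y * y ≤ 1 := by
      have h1 : t + star y * y ≤ t + r' := by gcongr
      refine h1.trans ?_
      rw [hr']
      simpa using proj_le_one hrs hrr
    refine hx y hyM hpy hyr ?_ ?_
    · apply norm_le_one_of_star_mul_le
      rw [star_add, add_mul, mul_add, mul_add, hxy, hyx, ← ht]
      simpa using hsum
    · apply norm_le_one_of_star_mul_le
      rw [star_sub, sub_mul, mul_sub, mul_sub, hxy, hyx, ← ht]
      simpa using hsum
  have hzero : ∀ m ∈ M, p' * m * r' = 0 := by
    intro m hm
    have h1 := hzero1 ((‖p' * m * r'‖ + 1)⁻¹ • m) (rsmul_mem M _ hm) (by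
      rw [mul_smul_comm, smul_mul_assoc, norm_smul, norm_inv, Real.norm_eq_abs,
        abs_of_nonneg (by positivity), inv_mul_le_iff₀ (by positivity)]
      linarith)
    rw [mul_smul_comm, smul_mul_assoc] at h1
    rcases smul_eq_zero.1 h1 with h | h
    · have : 0 < (‖p' * m * r'‖ + 1)⁻¹ := by positivity
      rw [h] at this
      exact absurd this (lt_irrefl _)
    · exact h
  have hp'ne : p' ≠ 0 := by
    intro h0
    refine hno ⟨star x, star_mem hxM, ?_, ?_⟩
    · rw [star_star]
      exact (sub_eq_zero.1 h0).symm
    · have : x * q = 0 := by rw [← hxr, mul_assoc, hrq, mul_zero]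
      have := congrArg star this
      rwa [star_mul, hqs, star_zero] at this
  let K : Submodule ℂ H := Submodule.span ℂ {w | ∃ m ∈ M, ∃ v, w = m (p' v)}
  have hKM : ∀ a : H →L[ℂ] H, a ∈ M → ∀ v ∈ K, a v ∈ K := by
    intro a ha v hv
    have : K ≤ K.comap a.toLinearMap := by
      refine Submodule.span_le.2 ?_
      rintro w ⟨m, hm, v, rfl⟩
      exact Submodule.subset_span ⟨a * m, mul_mem ha hm, v, rfl⟩
    exact this hv
  have hKM' : ∀ a ∈ M.commutant, ∀ v ∈ K, a v ∈ K := by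
    intro a ha v hv
    have : K ≤ K.comap a.toLinearMap := by
      refine Submodule.span_le.2 ?_
      rintro w ⟨m, hm, v, rfl⟩
      refine Submodule.subset_span ⟨m, hm, a v, ?_⟩
      have h1 := comm_of_mem M (mul_mem hm hp'M) ha
      exact (congrArg (fun z : H →L[ℂ] H => z v) h1).symm
    exact this hv
  have hzM := proj_mem M K hKM'
  have hzM' : K.topologicalClosure.starProjection ∈ M.commutant := by
    refine proj_mem M.commutant K ?_
    rw [VonNeumannAlgebra.commutant_commutant]
    exact hKM
  have hzs := proj_star K
  have hzz := proj_mul K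
  have hze : e0 * K.topologicalClosure.starProjection = 1 * K.topologicalClosure.starProjection := by
    apply proj_eq
    intro v hv
    have : K ≤ LinearMap.eqLocus e0.toLinearMap (1 : H →L[ℂ] H).toLinearMap := by
      refine Submodule.span_le.2 ?_
      rintro w ⟨m, hm, v, rfl⟩
      have h1 : e0 * (m * p') = m * p' := by
        rw [← mul_assoc, he0c m hm, mul_assoc, ← hpp', ← mul_assoc e0, hep]
      exact congrArg (fun z : H →L[ℂ] H => z v) h1
    exact this hv
  have hzr : r' * K.topologicalClosure.starProjection = 0 * K.topologicalClosure.starProjection := by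
    apply proj_eq
    intro v hv
    have : K ≤ LinearMap.eqLocus r'.toLinearMap (0 : H →L[ℂ] H).toLinearMap := by
      refine Submodule.span_le.2 ?_
      rintro w ⟨m, hm, v, rfl⟩
      have h1 : r' * (m * p') = 0 := by
        have := congrArg star (hzero (star m) (star_mem hm))
        rwa [star_mul, star_mul, star_star, hp's, hr's, star_zero] at this
      exact congrArg (fun z : H →L[ℂ] H => z v) h1
    exact this hv
  have hzp : K.topologicalClosure.starProjection * p' = p' := by
    ext v
    exact proj_apply K (Submodule.subset_span ⟨1, one_mem M, v, rfl⟩)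
  generalize K.topologicalClosure.starProjection = z at *
  refine ⟨z, ?_, hzs, hzz, by rwa [one_mul] at hze, ?_, ?_⟩
  · have h1 : z = q * z + t * z := by
      rw [zero_mul, hr', hr, sub_mul, sub_mul, one_mul, sub_sub, sub_eq_zero] at hzr
      exact hzr
    rw [h1]
    refine (hqJ.right hφ hzM).add hφ (JJ.right hφ ?_ hzM)
    rw [ht, ← hpx]
    exact (hpJ.right hφ hxM).left (star_mem (mul_mem hpM hxM))
  · rintro rfl
    rw [zero_mul] at hzp
    exact hp'ne hzp.symm
  · intro m hm
    exact (comm_of_mem M hm hzM').symm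

end Central

end TG
namespace TG

open Filter Topology ContinuousLinearMap

section Normal

variable {H : Type} [NormedAddCommGroup H] [InnerProductSpace ℂ H] [CompleteSpace H]
variable {M : VonNeumannAlgebra H} {φ : (H →L[ℂ] H) →ₗ[ℂ] ℂ}

/-- the central projections in the ideal -/
def CZ (M : VonNeumannAlgebra H) (φ : (H →L[ℂ] H) →ₗ[ℂ] ℂ) (z : H →L[ℂ] H) : Prop :=
  JJ M φ z ∧ star z = z ∧ z * z = z ∧ ∀ m ∈ M, z * m = m * z

theorem CZ.zero : CZ M φ (0 : H →L[ℂ] H) := by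
  refine ⟨⟨zero_mem M, Empty, inferInstance, fun x => x.elim, ?_⟩, by simp, by simp, by simp⟩
  intro x _
  simp [n2]

theorem exists_max_seq (hφ : IsTr M φ) (hφ1 : (φ 1).re = 1) :
    ∃ z : ℕ → (H →L[ℂ] H), (∀ n, CZ M φ (z n)) ∧
      ∀ e, CZ M φ e → (∀ n, z n * e = 0) → e = 0 := by
  let S : Set ℝ := {s | ∃ z, CZ M φ z ∧ s = (φ z).re}
  have hne : S.Nonempty := ⟨_, 0, CZ.zero, rfl⟩
  have hbdd : BddAbove S := by
    refine ⟨1, ?_⟩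
    rintro s ⟨z, hz, rfl⟩
    rw [← hφ1]
    exact hφ.mono hz.1.1 (one_mem M) (proj_le_one hz.2.1 hz.2.2.1)
  have h1 : ∀ n : ℕ, ∃ z, CZ M φ z ∧ sSup S - 1 / ((n : ℝ) + 1) < (φ z).re := by
    intro n
    obtain ⟨s, ⟨z, hz, rfl⟩, hs⟩ := exists_lt_of_lt_csSup hne
      (show sSup S - 1 / ((n : ℝ) + 1) < sSup S by
        have : 0 < 1 / ((n : ℝ) + 1) := by positivity
        linarith)
    exact ⟨z, hz, hs⟩
  choose z hz hzs using h1
  refine ⟨z, hz, ?_⟩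
  intro e he hze
  by_contra hene
  have hpos : 0 < (φ e).re := by
    rcases lt_or_ge 0 (φ e).re with h | h
    · exact h
    · exact absurd (hφ.eq_zero he.1.1 (proj_nonneg he.2.1 he.2.2.1) h) hene
  obtain ⟨n, hn⟩ := exists_nat_gt (1 / (φ e).re)
  rw [div_lt_iff₀ hpos] at hn
  have hez : e * z n = 0 := by rw [he.2.2.2 _ (hz n).1.1, hze]
  have h2 : CZ M φ (z n + e) := by
    refine ⟨(hz n).1.add hφ he.1, by rw [star_add, (hz n).2.1, he.2.1], ?_, ?_⟩
    · rw [add_mul, mul_add, mul_add, (hz n).2.2.1, he.2.2.1, hze, hez]; simp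
    · intro m hm
      rw [add_mul, mul_add, (hz n).2.2.2 m hm, he.2.2.2 m hm]
  have h3 : (φ (z n + e)).re ≤ sSup S := le_csSup hbdd ⟨_, h2, rfl⟩
  rw [map_add, Complex.add_re] at h3
  have h4 := hzs n
  have h5 : 1 / ((n : ℝ) + 1) < (φ e).re := by
    rw [div_lt_iff₀ (by positivity)]
    nlinarith
  linarith

/-- a faithful trace dominated by a summable family of vector functionals -/
structure IsNTr (M : VonNeumannAlgebra H) (ψ : (H →L[ℂ] H) →ₗ[ℂ] ℂ) : Prop where
  tr : IsTr M ψ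
  normal : ∃ (ι : Type) (η : ι → H), Summable (fun i => ‖η i‖ ^ 2) ∧
    ∀ x ∈ M, n2 ψ x ≤ ∑' i, ‖x (η i)‖ ^ 2

theorem hasSum_mem (M : VonNeumannAlgebra H) {f : ℕ → (H →L[ℂ] H)} {h : H →L[ℂ] H}
    (hs : HasSum f h) (hf : ∀ n, f n ∈ M) : h ∈ M := by
  refine mem_of_comm M fun t ht => ?_
  have h1 := hs.mul_left t
  have h2 := hs.mul_right t
  have h3 : (fun n => t * f n) = fun n => f n * t := by
    ext1 n
    exact (comm_of_mem M (hf n) ht).symm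
  rw [h3] at h1
  exact h1.unique h2

theorem exists_density (hφ : IsTr M φ) (hφ1 : (φ 1).re = 1) :
    ∃ h ∈ M, (∀ m ∈ M, h * m = m * h) ∧ IsNTr M (φ ∘ₗ LinearMap.mulLeft ℂ h) := by
  obtain ⟨z, hz, hmax⟩ := exists_max_seq hφ hφ1
  have hJ := fun n => (hz n).1.2
  choose ι ιf ξ hξ using hJ
  let c : ℕ → ℝ := fun n => (1 + ∑ i, ‖ξ n i‖ ^ 2)⁻¹
  let d : ℕ → ℝ := fun n => (1 / 2) ^ n * c n
  have hden : ∀ n, 0 < 1 + ∑ i, ‖ξ n i‖ ^ 2 := fun n =>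
    add_pos_of_pos_of_nonneg one_pos (Finset.sum_nonneg fun i _ => by positivity)
  have hcpos : ∀ n, 0 < c n := fun n => inv_pos.2 (hden n)
  have hc1 : ∀ n, c n ≤ 1 := fun n => inv_le_one_of_one_le₀ (by
    have : 0 ≤ ∑ i, ‖ξ n i‖ ^ 2 := Finset.sum_nonneg fun i _ => by positivity
    linarith)
  have hdpos : ∀ n, 0 < d n := fun n => mul_pos (by positivity) (hcpos n)
  have hd1 : ∀ n, d n ≤ (1 / 2) ^ n := fun n =>
    mul_le_of_le_one_right (by positivity) (hc1 n)
  have hdξ : ∀ n, d n * ∑ i, ‖ξ n i‖ ^ 2 ≤ (1 / 2) ^ n := by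
    intro n
    simp only [d, c]
    rw [mul_assoc]
    refine mul_le_of_le_one_right (by positivity) ?_
    rw [inv_mul_le_iff₀ (hden n)]
    linarith
  have hgeo : Summable (fun n : ℕ => ((1 : ℝ) / 2) ^ n) := summable_geometric_two
  have hzn : ∀ n, ‖z n‖ ≤ 1 := fun n =>
    norm_le_one_of_nonneg_le (proj_nonneg (hz n).2.1 (hz n).2.2.1)
      (proj_le_one (hz n).2.1 (hz n).2.2.1)
  have hsum : Summable (fun n => d n • z n) := by
    refine Summable.of_norm_bounded hgeo ?_
    intro n
    rw [norm_smul, Real.norm_eq_abs, abs_of_pos (hdpos n)]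
    exact (mul_le_of_le_one_right (hdpos n).le (hzn n)).trans (hd1 n)
  obtain ⟨h, hh⟩ := hsum
  have hhM : h ∈ M := hasSum_mem M hh fun n => rsmul_mem M _ (hz n).1.1
  have hcomm : ∀ m ∈ M, h * m = m * h := by
    intro m hm
    have h1 := hh.mul_left m
    have h2 := hh.mul_right m
    have h3 : (fun n => m * (d n • z n)) = fun n => (d n • z n) * m := by
      ext1 n
      rw [mul_smul_comm, smul_mul_assoc, (hz n).2.2.2 m hm]
    rw [h3] at h1
    exact h2.unique h1
  have hinn : ∀ v : H, HasSum (fun n => d n * ‖z n v‖ ^ 2) (inner ℂ v (h v)).re := by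
    intro v
    have h1 : HasSum (fun n => (d n • z n) v) (h v) := by
      have := (ContinuousLinearMap.apply ℂ H v).hasSum hh
      exact this
    have h2 := (innerSL ℂ v).hasSum h1
    have h3 : HasSum _ (inner ℂ v (h v)).re := Complex.hasSum_re h2
    convert h3 using 1
    ext1 n
    have h4 : (d n • z n) v = ((d n : ℝ) : ℂ) • z n v := by
      rw [Complex.coe_smul]; rfl
    simp only [Function.comp_apply, innerSL_apply_apply, h4, inner_smul_right, Complex.re_ofReal_mul]
    congr 1
    have h5 : z n v = star (z n) (z n v) := by
      rw [(hz n).2.1]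
      exact (congrArg (fun w : H →L[ℂ] H => w v) (hz n).2.2.1).symm
    conv_rhs => rw [h5]
    rw [ContinuousLinearMap.star_eq_adjoint, ContinuousLinearMap.adjoint_inner_right,
        inner_self_eq_norm_sq_to_K]
    norm_cast
  have hhpos : 0 ≤ h := hh.nonneg (fun n =>
    smul_nonneg (hdpos n).le (proj_nonneg (hz n).2.1 (hz n).2.2.1))
  have hker : ∀ v, h v = 0 → ∀ n, z n v = 0 := by
    intro v hv n
    have h1 := hinn v
    rw [hv, inner_zero_right, Complex.zero_re] at h1
    have h2 := (hasSum_zero_iff_of_nonneg (fun n => by have := hdpos n; positivity)).1 h1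
    have h3 := congrFun h2 n
    simp only [Pi.zero_apply, mul_eq_zero, (hdpos n).ne', false_or] at h3
    simpa using h3
  have hinj : ∀ v, h v = 0 → v = 0 := by
    let K : Submodule ℂ H := LinearMap.ker h.toLinearMap
    have hKM : ∀ a : H →L[ℂ] H, a ∈ M → ∀ v ∈ K, a v ∈ K := by
      intro a ha v hv
      have h1 := congrArg (fun w : H →L[ℂ] H => w v) (hcomm a ha)
      have h2 : h v = 0 := hv
      have h3 : h (a v) = a (h v) := h1
      rw [h2, map_zero] at h3
      exact h3
    have hKM' : ∀ a ∈ M.commutant, ∀ v ∈ K, a v ∈ K := by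
      intro a ha v hv
      have h1 := congrArg (fun w : H →L[ℂ] H => w v) (comm_of_mem M hhM ha)
      have h2 : h v = 0 := hv
      have h3 : h (a v) = a (h v) := h1
      rw [h2, map_zero] at h3
      exact h3
    have heM := proj_mem M K hKM'
    have heM' : K.topologicalClosure.starProjection ∈ M.commutant := by
      refine proj_mem M.commutant K ?_
      rw [VonNeumannAlgebra.commutant_commutant]
      exact hKM
    have hze : ∀ n, z n * K.topologicalClosure.starProjection =
        0 * K.topologicalClosure.starProjection := by
      intro n
      apply proj_eq
      intro v hv
      exact hker v hv n
    by_cases he : K.topologicalClosure.starProjection = 0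
    · intro v hv
      have := proj_apply K (v := v) hv
      rw [he] at this
      exact this.symm
    · exfalso
      obtain ⟨e, heJ, hes, hee, he0, hne, hec⟩ := exists_central hφ hφ1 heM (proj_star K)
        (proj_mul K) he (fun m hm => (comm_of_mem M hm heM').symm)
      refine hne (hmax e ⟨heJ, hes, hee, hec⟩ fun n => ?_)
      rw [← he0, ← mul_assoc, hze, zero_mul, zero_mul]
  obtain ⟨k, hkM, -, hks, hkk, hkc⟩ := exists_sqrt M hhM hhpos
  have hψ : ∀ x, (φ ∘ₗ LinearMap.mulLeft ℂ h) x = φ (h * x) := fun x => rfl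
  have hψn : ∀ x ∈ M, n2 (φ ∘ₗ LinearMap.mulLeft ℂ h) x = n2 φ (x * k) := by
    intro x hx
    unfold n2
    rw [hψ, ← hkk, star_mul, hks, show k * k * (star x * x) = k * (k * (star x * x)) by
      simp only [mul_assoc], hkc _ (hcomm _ (mul_mem (star_mem hx) hx))]
    simp only [mul_assoc]
  have hψsum : ∀ y ∈ M, HasSum (fun n => d n * (φ (z n * y)).re) (φ (h * y)).re := by
    intro y hy
    have h1 : Tendsto (fun s : Finset ℕ => ∑ n ∈ s, d n • z n) atTop (𝓝 h) := hh
    have h2 : Tendsto (fun s : Finset ℕ => ‖(∑ n ∈ s, d n • z n) - h‖ * (‖y‖ * (φ 1).re)) atTop (𝓝 0) := by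
      have := (tendsto_iff_norm_sub_tendsto_zero.1 h1).mul_const (‖y‖ * (φ 1).re)
      rwa [zero_mul] at this
    change Tendsto (fun s : Finset ℕ => ∑ n ∈ s, d n * (φ (z n * y)).re) atTop _
    rw [tendsto_iff_norm_sub_tendsto_zero]
    refine squeeze_zero (fun s => norm_nonneg _) (fun s => ?_) h2
    have h3 : ∑ n ∈ s, d n * (φ (z n * y)).re - (φ (h * y)).re =
        (φ (((∑ n ∈ s, d n • z n) - h) * y)).re := by
      rw [sub_mul, map_sub, Complex.sub_re, Finset.sum_mul, map_sum, Complex.re_sum]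
      congr 1
      refine Finset.sum_congr rfl fun n _ => ?_
      rw [smul_mul_assoc, rsmul_re]
    have hM : (∑ n ∈ s, d n • z n) - h ∈ M :=
      sub_mem (sum_mem fun n _ => rsmul_mem M _ (hz n).1.1) hhM
    rw [h3, Real.norm_eq_abs]
    refine (Complex.abs_re_le_norm _).trans ?_
    refine (hφ.norm_le (mul_mem hM hy)).trans ?_
    rw [← mul_assoc]
    have h4 : 0 ≤ (φ 1).re := by rw [hφ1]; norm_num
    gcongr
    exact norm_mul_le _ _
  refine ⟨h, hhM, hcomm, ⟨?_, ?_, ?_, ?_⟩, ?_⟩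
  · intro x hx y hy
    rw [hψ, hψ, ← mul_assoc, hφ.tracial _ (mul_mem hhM hx) y hy, ← mul_assoc, ← hcomm y hy,
      mul_assoc]
  · intro x hx
    rw [hψ, hψ, ← hφ.star_eq _ (mul_mem hhM hx), star_mul, hhpos.isSelfAdjoint.star_eq,
      hcomm _ (star_mem hx)]
  · intro x hx
    have := hψn x hx
    unfold n2 at this
    rw [this]
    exact hφ.n2_nonneg (mul_mem hx hkM)
  · intro x hx h0
    have h1 : n2 φ (x * k) = 0 := by rw [← hψn x hx]; exact h0
    have h2 := hφ.n2_eq_zero (mul_mem hx hkM) h1.le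
    have h3 : h * x = 0 := by rw [hcomm x hx, ← hkk, ← mul_assoc, h2, zero_mul]
    ext v
    exact hinj _ (congrArg (fun w : H →L[ℂ] H => w v) h3)
  · refine ⟨Σ n, ι n, fun i => ((Real.sqrt (d i.1) : ℝ) : ℂ) • ξ i.1 i.2, ?_, ?_⟩
    · have hn : ∀ i : Σ n, ι n, ‖((Real.sqrt (d i.1) : ℝ) : ℂ) • ξ i.1 i.2‖ ^ 2 =
          d i.1 * ‖ξ i.1 i.2‖ ^ 2 := by
        intro i
        rw [norm_smul, mul_pow, Complex.norm_real, Real.norm_eq_abs, sq_abs,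
          Real.sq_sqrt (hdpos _).le]
      simp_rw [hn]
      refine (summable_sigma_of_nonneg (fun i => by have := hdpos i.1; positivity)).2 ⟨?_, ?_⟩
      · intro n
        exact Summable.of_finite
      · refine Summable.of_nonneg_of_le (fun n => tsum_nonneg fun i => by have := hdpos n; positivity)
          (fun n => ?_) hgeo
        rw [tsum_fintype]
        have := hdξ n
        rwa [Finset.mul_sum] at this
    · intro x hx
      have hn : ∀ i : Σ n, ι n, ‖x (((Real.sqrt (d i.1) : ℝ) : ℂ) • ξ i.1 i.2)‖ ^ 2 =
          d i.1 * ‖x (ξ i.1 i.2)‖ ^ 2 := by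
        intro i
        rw [map_smul, norm_smul, mul_pow, Complex.norm_real, Real.norm_eq_abs, sq_abs,
          Real.sq_sqrt (hdpos _).le]
      simp_rw [hn]
      have hxb : ∀ n, ∑ i, ‖x (ξ n i)‖ ^ 2 ≤ ‖x‖ ^ 2 * ∑ i, ‖ξ n i‖ ^ 2 := by
        intro n
        rw [Finset.mul_sum]
        refine Finset.sum_le_sum fun i _ => ?_
        rw [← mul_pow]
        gcongr
        exact x.le_opNorm _
      have hsm : Summable (fun n => d n * ∑ i, ‖x (ξ n i)‖ ^ 2) := by
        refine Summable.of_nonneg_of_le (fun n => mul_nonneg (hdpos n).le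
          (Finset.sum_nonneg fun i _ => by positivity)) (fun n => ?_) (hgeo.mul_left (‖x‖ ^ 2))
        refine (mul_le_mul_of_nonneg_left (hxb n) (hdpos n).le).trans ?_
        have := mul_le_mul_of_nonneg_left (hdξ n) (sq_nonneg ‖x‖)
        linarith
      have hsg : Summable (fun i : Σ n, ι n => d i.1 * ‖x (ξ i.1 i.2)‖ ^ 2) := by
        refine (summable_sigma_of_nonneg (fun i => by have := hdpos i.1; positivity)).2 ⟨?_, ?_⟩
        · intro n
          exact Summable.of_finite
        · refine hsm.congr fun n => ?_
          rw [tsum_fintype, Finset.mul_sum]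
      rw [hsg.tsum_sigma' (fun n => Summable.of_finite)]
      have h1 := hψsum (star x * x) (mul_mem (star_mem hx) hx)
      have h2 : n2 (φ ∘ₗ LinearMap.mulLeft ℂ h) x = (φ (h * (star x * x))).re := rfl
      rw [h2, ← h1.tsum_eq]
      have h3 : ∀ n, ∑' i : ι n, d n * ‖x (ξ n i)‖ ^ 2 = d n * ∑ i, ‖x (ξ n i)‖ ^ 2 := by
        intro n
        rw [tsum_fintype, ← Finset.mul_sum]
      simp_rw [h3]
      refine Summable.tsum_le_tsum (fun n => ?_) h1.summable hsm
      refine mul_le_mul_of_nonneg_left ?_ (hdpos n).le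
      have h4 : (φ (z n * (star x * x))).re = n2 φ (x * z n) := by
        have h5 : star (x * z n) * (x * z n) = z n * (star x * x) := by
          rw [star_mul, (hz n).2.1, show z n * star x * (x * z n) = z n * (star x * x * z n) by
            simp only [mul_assoc], ← (hz n).2.2.2 _ (mul_mem (star_mem hx) hx),
            show z n * (z n * (star x * x)) = (z n * z n) * (star x * x) by
              simp only [mul_assoc], (hz n).2.2.1]
        unfold n2
        rw [h5]
      rw [h4]
      exact hξ n x hx

end Normal

end TG
namespace TG
open Filter Topology ContinuousLinearMap

section Amp

variable {H : Type} [NormedAddCommGroup H] [InnerProductSpace ℂ H] [CompleteSpace H]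

/-- the amplified Hilbert space -/
abbrev KK (ι : Type) (H : Type) [NormedAddCommGroup H] [InnerProductSpace ℂ H] [CompleteSpace H] :=
  lp (fun _ : ι => H) 2

variable {ι : Type}

theorem kk_summable (v : KK ι H) : Summable (fun i => ‖v i‖ ^ 2) := by
  have := (lp.memℓp v).summable (by norm_num)
  simpa using this

theorem kk_norm (v : KK ι H) : ‖v‖ ^ 2 = ∑' i, ‖v i‖ ^ 2 := by
  have := lp.norm_rpow_eq_tsum (p := 2) (by norm_num) v
  simpa using this

theorem kk_mem {f : ι → H} (hf : Summable (fun i => ‖f i‖ ^ 2)) : Memℓp f 2 := by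
  apply memℓp_gen
  simpa using hf

theorem kk_smb (a : H →L[ℂ] H) {f : ι → H} (hf : Summable (fun i => ‖f i‖ ^ 2)) :
    Summable (fun i => ‖a (f i)‖ ^ 2) := by
  refine Summable.of_nonneg_of_le (fun i => by positivity) (fun i => ?_) (hf.mul_left (‖a‖ ^ 2))
  rw [← mul_pow]
  gcongr
  exact a.le_opNorm _

/-- amplification as a linear map -/
def ampL (a : H →L[ℂ] H) : KK ι H →ₗ[ℂ] KK ι H where
  toFun v := ⟨fun i => a (v i), kk_mem (kk_smb a (kk_summable v))⟩
  map_add' v w := by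
    ext i
    exact map_add a (v i) (w i)
  map_smul' c v := by
    ext i
    simp

/-- amplification -/
def amp (a : H →L[ℂ] H) : KK ι H →L[ℂ] KK ι H :=
  (ampL a).mkContinuous ‖a‖ fun v => by
    have h : ‖ampL a v‖ ^ 2 ≤ (‖a‖ * ‖v‖) ^ 2 := by
      rw [mul_pow, kk_norm, kk_norm, ← tsum_mul_left]
      refine Summable.tsum_le_tsum (fun i => ?_) (kk_summable _) ((kk_summable v).mul_left _)
      rw [← mul_pow]
      have := a.le_opNorm (v i)
      change ‖a (v i)‖ ^ 2 ≤ _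
      gcongr
    exact (sq_le_sq₀ (norm_nonneg _) (by positivity)).1 h

theorem amp_apply (a : H →L[ℂ] H) (v : KK ι H) (i : ι) : amp a v i = a (v i) := rfl

theorem amp_inner (a : H →L[ℂ] H) (v w : KK ι H) :
    inner ℂ v (amp a w) = inner ℂ (amp (star a) v) w := by
  rw [lp.inner_eq_tsum, lp.inner_eq_tsum]
  refine tsum_congr fun i => ?_
  rw [amp_apply, amp_apply, star_eq_adjoint, adjoint_inner_left]

theorem amp_mul (a b : H →L[ℂ] H) (v : KK ι H) : amp (a * b) v = amp a (amp b v) := rfl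

theorem amp_single (a : H →L[ℂ] H) (i : ι) (x : H) :
    amp a (lp.single 2 i x : KK ι H) = lp.single 2 i (a x) := by
  ext j
  rw [amp_apply]
  by_cases h : j = i
  · subst h
    simp
  · rw [lp.single_apply_ne _ _ _ h, lp.single_apply_ne _ _ _ h, map_zero]

/-- the vector map `x ↦ (x η i)` -/
def ampV {η : ι → H} (hη : Summable (fun i => ‖η i‖ ^ 2)) : KK ι H := ⟨η, kk_mem hη⟩

theorem amp_add (a b : H →L[ℂ] H) (v : KK ι H) : amp (a + b) v = amp a v + amp b v := by
  ext i
  simp [amp_apply]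

theorem amp_sub (a b : H →L[ℂ] H) (v : KK ι H) : amp (a - b) v = amp a v - amp b v := by
  ext i
  simp [amp_apply]

theorem amp_smul (c : ℂ) (b : H →L[ℂ] H) (v : KK ι H) : amp (c • b) v = c • amp b v := by
  ext i
  simp [amp_apply]

/-- The amplified density theorem. -/
theorem amp_density (S : Set (H →L[ℂ] H)) (h1 : 1 ∈ S) (hm : ∀ x ∈ S, ∀ y ∈ S, x * y ∈ S)
    (hs : ∀ x ∈ S, star x ∈ S) {b : H →L[ℂ] H}
    (hb : ∀ t : H →L[ℂ] H, (∀ x ∈ S, x * t = t * x) → b * t = t * b) (v : KK ι H) :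
    amp b v ∈ (Submodule.span ℂ ((fun x => amp x v) '' S)).topologicalClosure := by
  set L := Submodule.span ℂ ((fun x => amp x v) '' S) with hL
  set W := L.topologicalClosure with hW
  have hinvL : ∀ a ∈ S, ∀ w ∈ L, amp a w ∈ L := by
    intro a ha w hw
    refine Submodule.span_induction (p := fun w _ => amp a w ∈ L) ?_ ?_ ?_ ?_ hw
    · rintro _ ⟨x, hx, rfl⟩
      exact Submodule.subset_span ⟨a * x, hm a ha x hx, rfl⟩
    · rw [map_zero]; exact zero_mem _
    · intro x y _ _ hx hy
      rw [map_add]; exact add_mem hx hy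
    · intro c x _ hx
      rw [map_smul]; exact Submodule.smul_mem _ _ hx
  have hinv : ∀ a ∈ S, ∀ w ∈ W, amp a w ∈ W := by
    intro a ha w hw
    exact map_mem_closure (amp a).continuous hw (fun y hy => hinvL a ha y hy)
  have : CompleteSpace W := by
    exact (Submodule.isClosed_topologicalClosure L).completeSpace_coe
  have hcom : ∀ a ∈ S, ∀ w, W.starProjection (amp a w) = amp a (W.starProjection w) := by
    intro a ha w
    refine Submodule.eq_starProjection_of_mem_of_inner_eq_zero
      (hinv a ha _ (Submodule.starProjection_apply_mem W w)) ?_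
    intro u hu
    rw [← map_sub, ← inner_conj_symm, amp_inner, inner_conj_symm]
    have h2 := hinv (star a) (hs a ha) u hu
    exact Submodule.starProjection_inner_eq_zero w _ h2
  have hent : ∀ i j : ι, ∀ x : H,
      b (W.starProjection (lp.single 2 i x : KK ι H) j) =
        W.starProjection (lp.single 2 i (b x) : KK ι H) j := by
    intro i j x
    let F : H →L[ℂ] H := (lp.evalCLM ℂ (fun _ : ι => H) 2 j).comp
      (W.starProjection.comp (lp.singleContinuousLinearMap ℂ (fun _ : ι => H) 2 i))
    have hF : ∀ y, F y = W.starProjection (lp.single 2 i y : KK ι H) j := fun y => rfl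
    have h3 := hb F (fun a ha => by
      ext y
      change a (F y) = F (a y)
      rw [hF, hF, ← amp_single, hcom a ha, amp_apply])
    exact congrArg (fun w : H →L[ℂ] H => w x) h3
  have hball : ∀ w, amp b (W.starProjection w) = W.starProjection (amp b w) := by
    intro w
    have h4 := lp.hasSum_single (p := 2) (by norm_num) w
    have h5 := ((amp b).comp W.starProjection).hasSum h4
    have h6 := (W.starProjection.comp (amp b)).hasSum h4
    have h8 : (fun i => ((amp b).comp W.starProjection) (lp.single 2 i (w i) : KK ι H)) =
        fun i => (W.starProjection.comp (amp b)) (lp.single 2 i (w i) : KK ι H) := by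
     funext i
     change amp b (W.starProjection (lp.single 2 i (w i) : KK ι H)) =
      W.starProjection (amp b (lp.single 2 i (w i) : KK ι H))
     rw [amp_single]
     ext j
     rw [amp_apply, hent]
    rw [h8] at h5
    exact h5.unique h6
  have hv : v ∈ W := by
    refine Submodule.le_topologicalClosure _ (Submodule.subset_span ⟨1, h1, ?_⟩)
    rfl
  have h7 := hball v
  rw [Submodule.starProjection_eq_self_iff.2 hv] at h7
  rw [h7]
  exact Submodule.starProjection_apply_mem W _

end Amp

section Norm

variable {H : Type} [NormedAddCommGroup H] [InnerProductSpace ℂ H] [CompleteSpace H]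
variable {M : VonNeumannAlgebra H} {ψ : (H →L[ℂ] H) →ₗ[ℂ] ℂ}

theorem IsNTr.exists_vec (h : IsNTr M ψ) : ∃ (ι : Type) (v : KK ι H),
    ∀ x ∈ M, n2 ψ x ≤ ‖amp x v‖ ^ 2 := by
  obtain ⟨ι, η, hη, hle⟩ := h.normal
  refine ⟨ι, ampV hη, fun x hx => ?_⟩
  rw [kk_norm]
  exact hle x hx

/-- normal functionals vanish on the generated algebra when they vanish on generators -/
theorem IsNTr.density (h : IsNTr M ψ) (S : Set (H →L[ℂ] H)) (hSM : ∀ x ∈ S, x ∈ M)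
    (h1 : 1 ∈ S) (hm : ∀ x ∈ S, ∀ y ∈ S, x * y ∈ S)
    (hs : ∀ x ∈ S, star x ∈ S) {b d : H →L[ℂ] H} (hbM : b ∈ M) (hd : d ∈ M)
    (hb : ∀ t : H →L[ℂ] H, (∀ x ∈ S, x * t = t * x) → b * t = t * b)
    (h0 : ∀ x ∈ S, ψ (d * x) = 0) : ψ (d * b) = 0 := by
  obtain ⟨ι, v, hv⟩ := h.exists_vec
  have hcl := amp_density S h1 hm hs hb v
  have hspan : ∀ w ∈ Submodule.span ℂ ((fun x => amp x v) '' S),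
      ∃ x ∈ M, ψ (d * x) = 0 ∧ w = amp x v := by
    intro w hw
    refine Submodule.span_induction (p := fun w _ => ∃ x ∈ M, ψ (d * x) = 0 ∧ w = amp x v)
      ?_ ?_ ?_ ?_ hw
    · rintro _ ⟨x, hx, rfl⟩
      exact ⟨x, hSM x hx, h0 x hx, rfl⟩
    · refine ⟨0, zero_mem M, by simp, ?_⟩
      ext i
      simp [amp_apply]
    · rintro _ _ _ _ ⟨x, hx, hx0, rfl⟩ ⟨y, hy, hy0, rfl⟩
      exact ⟨x + y, add_mem hx hy, by rw [mul_add, map_add, hx0, hy0, add_zero],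
        (amp_add _ _ _).symm⟩
    · rintro c _ _ ⟨x, hx, hx0, rfl⟩
      exact ⟨c • x, smul_mem' M c hx, by rw [mul_smul_comm, map_smul, hx0, smul_zero],
        (amp_smul _ _ _).symm⟩
  by_contra hne
  have hpos : 0 < ‖ψ (d * b)‖ := norm_pos_iff.2 hne
  have hC : 0 ≤ n2 ψ (star d) := h.tr.n2_nonneg (star_mem hd)
  obtain ⟨w, hw, hlt⟩ := Metric.mem_closure_iff.1 hcl
    (‖ψ (d * b)‖ / (n2 ψ (star d) + 1)) (by positivity)
  obtain ⟨x, hx, hx0, rfl⟩ := hspan w hw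
  rw [dist_eq_norm, ← amp_sub] at hlt
  have h2 := h.tr.cs (star_mem hd) (sub_mem hbM hx)
  rw [star_star, mul_sub, map_sub, hx0, sub_zero] at h2
  have h3 := hv _ (sub_mem hbM hx)
  set r := ‖amp (b - x) v‖
  set C := n2 ψ (star d)
  set q := ‖ψ (d * b)‖
  have h4 : r * (C + 1) < q := (lt_div_iff₀ (by positivity)).1 hlt
  have h5 : (r * (C + 1)) ^ 2 < q ^ 2 := by
    have : 0 ≤ r * (C + 1) := by positivity
    gcongr
  have h6 : C * n2 ψ (b - x) ≤ C * r ^ 2 := by gcongr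
  nlinarith [sq_nonneg r, mul_nonneg hC (sq_nonneg r), mul_nonneg (mul_nonneg hC hC) (sq_nonneg r)]

/-- weak operator continuity on bounded sets -/
theorem IsNTr.tendsto (h : IsNTr M ψ) {κ : Type*} {U : Ultrafilter κ} {x : κ → (H →L[ℂ] H)}
    {C : ℝ} (hC : ∀ i, ‖x i‖ ≤ C) (hx : ∀ i, x i ∈ M) {y : H →L[ℂ] H} (hyM : y ∈ M)
    (hy : ∀ ξ η : H, Tendsto (fun i => inner ℂ η (x i ξ)) U (𝓝 (inner ℂ η (y ξ))))
    {m : H →L[ℂ] H} (hm : m ∈ M) :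
    Tendsto (fun i => ψ (x i * m)) U (𝓝 (ψ (y * m))) := by
  obtain ⟨ι, v, hv⟩ := h.exists_vec
  let T : M.toStarSubalgebra →ₗ[ℂ] KK ι H :=
    { toFun := fun x => amp (x : H →L[ℂ] H) v
      map_add' := fun a b => amp_add _ _ _
      map_smul' := fun c a => amp_smul _ _ _ }
  let g : M.toStarSubalgebra →ₗ[ℂ] ℂ :=
    { toFun := fun x => ψ ((x : H →L[ℂ] H) * m)
      map_add' := fun a b => by
        rw [← map_add, ← add_mul]; rfl
      map_smul' := fun c a => by
        rw [RingHom.id_apply, ← map_smul, ← smul_mul_assoc]; rfl }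
  have hg : ∀ a : M.toStarSubalgebra, ‖g a‖ ≤ Real.sqrt (n2 ψ m) * ‖T a‖ := by
    intro a
    have haM : (a : H →L[ℂ] H) ∈ M := a.2
    have h1 := h.tr.cs (star_mem haM) hm
    rw [star_star, h.tr.n2_star haM] at h1
    have h2 := hv _ haM
    have h3 := h.tr.n2_nonneg hm
    have h4 : ‖g a‖ ^ 2 ≤ (Real.sqrt (n2 ψ m) * ‖T a‖) ^ 2 := by
      rw [mul_pow, Real.sq_sqrt h3]
      refine h1.trans ?_
      rw [mul_comm]
      exact mul_le_mul_of_nonneg_left h2 h3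
    exact (sq_le_sq₀ (norm_nonneg _) (by positivity)).1 h4
  have hker : ∀ a, T a = 0 → g a = 0 := by
    intro a ha
    have := hg a
    rw [ha, norm_zero, mul_zero] at this
    exact norm_le_zero_iff.1 this
  have hker' : LinearMap.ker T ≤ LinearMap.ker g := fun a ha => hker a ha
  let f0 : LinearMap.range T →ₗ[ℂ] ℂ :=
    ((LinearMap.ker T).liftQ g hker').comp T.quotKerEquivRange.symm.toLinearMap
  have hf0 : ∀ a, f0 ⟨T a, LinearMap.mem_range_self T a⟩ = g a := by
    intro a
    have : T.quotKerEquivRange.symm ⟨T a, LinearMap.mem_range_self T a⟩ =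
        (LinearMap.ker T).mkQ a := LinearMap.quotKerEquivRange_symm_apply_image T a _
    change (LinearMap.ker T).liftQ g hker' (T.quotKerEquivRange.symm _) = g a
    rw [this]
    exact Submodule.liftQ_apply _ _ _
  let f1 : LinearMap.range T →L[ℂ] ℂ := f0.mkContinuous (Real.sqrt (n2 ψ m)) (by
    rintro ⟨_, a, rfl⟩
    rw [hf0]
    exact hg a)
  obtain ⟨f2, hf2, -⟩ := exists_extension_norm_eq (LinearMap.range T) f1
  let ζ := (InnerProductSpace.toDual ℂ (KK ι H)).symm f2
  have hζ : ∀ a ∈ M, ψ (a * m) = ∑' i, inner ℂ (ζ i) (a (v i)) := by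
    intro a ha
    have e1 : inner ℂ ζ (amp a v) = f2 (amp a v) := InnerProductSpace.toDual_symm_apply
    have e2 : f2 (amp a v) = g ⟨a, ha⟩ := by
      rw [← hf0]
      exact hf2 ⟨T ⟨a, ha⟩, LinearMap.mem_range_self T _⟩
    have e3 : g ⟨a, ha⟩ = ψ (a * m) := rfl
    rw [← e3, ← e2, ← e1, lp.inner_eq_tsum]
    rfl
  simp_rw [hζ _ (hx _)]
  rw [hζ y hyM]
  have hsum : Summable (fun i => ‖ζ i‖ * (C * ‖v i‖)) := by
    refine Summable.of_norm_bounded (g := fun i => ‖ζ i‖ ^ 2 + C ^ 2 * ‖v i‖ ^ 2)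
      ((kk_summable ζ).add ((kk_summable v).mul_left _)) fun i => ?_
    rw [Real.norm_eq_abs, abs_le]
    constructor <;> nlinarith [sq_nonneg (‖ζ i‖ - C * ‖v i‖), sq_nonneg (‖ζ i‖ + C * ‖v i‖)]
  refine tendsto_tsum_of_dominated_convergence hsum (fun i => hy _ _) ?_
  refine Eventually.of_forall fun k i => ?_
  refine (norm_inner_le_norm _ _).trans ?_
  gcongr
  exact (x k).le_of_opNorm_le (hC k) _

end Norm

end TG
namespace TG
open Filter Topology ContinuousLinearMap

section CE

variable {H : Type} [NormedAddCommGroup H] [InnerProductSpace ℂ H] [CompleteSpace H]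
variable {M B : VonNeumannAlgebra H} {ψ : (H →L[ℂ] H) →ₗ[ℂ] ℂ}

theorem IsTr.pos_mul (h : IsTr M ψ) {a b : H →L[ℂ] H} (ha : a ∈ M) (hb : b ∈ M)
    (ha0 : 0 ≤ a) (hb0 : 0 ≤ b) : 0 ≤ (ψ (a * b)).re := by
  obtain ⟨y, hy, -, hys, hyy, -⟩ := exists_sqrt M hb hb0
  have h1 := h.pos (mul_mem (mul_mem (star_mem hy) ha) hy) (conj_nonneg' ha0 y)
  rw [h.tracial _ (mul_mem (star_mem hy) ha) y hy, hys, ← mul_assoc, hyy,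
    h.tracial b hb a ha] at h1
  exact h1

theorem IsTr.im_sa (h : IsTr M ψ) {a b : H →L[ℂ] H} (ha : a ∈ M) (hb : b ∈ M)
    (has : star a = a) (hbs : star b = b) : (ψ (a * b)).im = 0 := by
  have h1 := h.star_eq (a * b) (mul_mem ha hb)
  rw [star_mul, has, hbs, h.tracial b hb a ha] at h1
  have := congrArg Complex.im h1
  simp at this
  linarith

/-- clamping decreases the distance to elements of the unit interval -/
theorem IsTr.clamp (h : IsTr M ψ) (hBM : ∀ x ∈ B, x ∈ M) {x b : H →L[ℂ] H} (hx : x ∈ M)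
    (hx0 : 0 ≤ x) (hx1 : x ≤ 1) (hb : b ∈ B) (hbs : star b = b) :
    ∃ c ∈ B, 0 ≤ c ∧ c ≤ 1 ∧ n2 ψ (x - c) ≤ n2 ψ (x - b) := by
  have hbsa : IsSelfAdjoint b := hbs
  set c := cfc (fun t : ℝ => max 0 (min t 1)) b with hc
  set u := cfc (fun t : ℝ => max (t - 1) 0) b with hu
  set v := cfc (fun t : ℝ => max (-t) 0) b with hv
  have hcB : c ∈ B := cfc_mem B _ hb
  have huM : u ∈ M := hBM _ (cfc_mem B _ hb)
  have hvM : v ∈ M := hBM _ (cfc_mem B _ hb)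
  have hcM : c ∈ M := hBM _ hcB
  have hc0 : 0 ≤ c := cfc_nonneg fun t _ => le_max_left _ _
  have hc1 : c ≤ 1 := cfc_le_one _ _ fun t _ => max_le zero_le_one (min_le_right _ _)
  have hu0 : 0 ≤ u := cfc_nonneg fun t _ => le_max_right _ _
  have hv0 : 0 ≤ v := cfc_nonneg fun t _ => le_max_right _ _
  have hcu : c * u = u := by
    rw [hc, hu, ← cfc_mul _ _ b (by fun_prop) (by fun_prop)]
    refine cfc_congr fun t _ => ?_
    rcases le_total t 1 with h1 | h1
    · rw [max_eq_right (by linarith : t - 1 ≤ 0), mul_zero]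
    · rw [min_eq_right h1, max_eq_right zero_le_one, one_mul]
  have hcv : c * v = 0 := by
    rw [hc, hv, ← cfc_mul _ _ b (by fun_prop) (by fun_prop), ← cfc_zero ℝ b]
    refine cfc_congr fun t _ => ?_
    change _ = (0 : ℝ)
    rcases le_total 0 t with h1 | h1
    · rw [max_eq_right (by linarith : -t ≤ 0), mul_zero]
    · rw [max_eq_left ((min_le_left _ _).trans h1), zero_mul]
  have hbe : b = c + (u - v) := by
    conv_lhs => rw [← cfc_id ℝ b hbsa]
    rw [hc, hu, hv, ← cfc_sub _ _ b (by fun_prop) (by fun_prop),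
      ← cfc_add b _ _ (by fun_prop) (by fun_prop)]
    refine cfc_congr fun t _ => ?_
    dsimp only [id]
    rcases le_total t 1 with h1 | h1
    · rw [max_eq_right (by linarith : t - 1 ≤ 0), min_eq_left h1]
      rcases le_total 0 t with h2 | h2
      · rw [max_eq_right h2, max_eq_right (by linarith : -t ≤ 0)]; ring
      · rw [max_eq_left h2, max_eq_left (by linarith : 0 ≤ -t)]; ring
    · rw [min_eq_right h1, max_eq_right zero_le_one, max_eq_left (by linarith : 0 ≤ t - 1),
        max_eq_right (by linarith : -t ≤ 0)]
      ring
  refine ⟨c, hcB, hc0, hc1, ?_⟩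
  have hcs : star c = c := hc0.isSelfAdjoint.star_eq
  have hus : star u = u := hu0.isSelfAdjoint.star_eq
  have hvs : star v = v := hv0.isSelfAdjoint.star_eq
  have hxs : star x = x := hx0.isSelfAdjoint.star_eq
  have k1 : 0 ≤ (ψ ((1 - x) * u)).re :=
    h.pos_mul (sub_mem (one_mem M) hx) huM (sub_nonneg.2 hx1) hu0
  have k2 : 0 ≤ (ψ (x * v)).re := h.pos_mul hx hvM hx0 hv0
  have k3 := h.n2_nonneg (sub_mem huM hvM)
  have k4 : n2 ψ (x - b) = n2 ψ (x - c) - 2 * (ψ ((x - c) * (u - v))).re + n2 ψ (u - v) := by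
    have e1 : x - b = (x - c) - (u - v) := by rw [hbe]; abel
    have e2 : star (x - c) = x - c := by rw [star_sub, hxs, hcs]
    have e3 : star (u - v) = u - v := by rw [star_sub, hus, hvs]
    have e4 : star ((x - c) - (u - v)) = (x - c) - (u - v) := by rw [star_sub, e2, e3]
    unfold n2
    rw [e1, e4, e2, e3]
    have e5 := h.tracial _ (sub_mem hx hcM) _ (sub_mem huM hvM)
    rw [sub_mul, mul_sub, mul_sub (u - v), map_sub, map_sub, map_sub, ← e5]
    simp only [Complex.sub_re]
    ring
  have k5 : (ψ ((x - c) * (u - v))).re = - (ψ ((1 - x) * u)).re - (ψ (x * v)).re := by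
    have : (x - c) * (u - v) = -((1 - x) * u) - x * v := by
      rw [sub_mul, mul_sub, mul_sub, hcu, hcv, sub_mul, one_mul]
      abel
    rw [this, map_sub, map_neg]
    simp
  linarith

theorem IsNTr.exists_min (h : IsNTr M ψ) (hBM : ∀ x ∈ B, x ∈ M) {x : H →L[ℂ] H} (hx : x ∈ M)
    (hx0 : 0 ≤ x) : ∃ y ∈ B, 0 ≤ y ∧ y ≤ 1 ∧
      ∀ c ∈ B, 0 ≤ c → c ≤ 1 → n2 ψ (x - y) ≤ n2 ψ (x - c) := by
  let S : Set ℝ := {r | ∃ c ∈ B, 0 ≤ c ∧ c ≤ 1 ∧ r = n2 ψ (x - c)}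
  have hne : S.Nonempty := ⟨_, 0, zero_mem B, le_rfl, zero_le_one, rfl⟩
  have hbd : BddBelow S := by
    refine ⟨0, ?_⟩
    rintro _ ⟨c, hc, -, -, rfl⟩
    exact h.tr.n2_nonneg (sub_mem hx (hBM c hc))
  obtain ⟨r, -, hr, hrS⟩ := exists_seq_tendsto_sInf hne hbd
  choose b hbB hb0 hb1 hbr using hrS
  let U : Ultrafilter ℕ := hyperfilter ℕ
  have hUle : (U : Filter ℕ) ≤ atTop := by
    rw [← Nat.cofinite_eq_atTop]
    exact hyperfilter_le_cofinite
  have hbn : ∀ n, ‖b n‖ ≤ 1 := fun n => norm_le_one_of_nonneg_le (hb0 n) (hb1 n)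
  obtain ⟨y, -, hy⟩ := ultralim U b 1 hbn
  have hyB : y ∈ B := ultralim_mem B hbB hy
  have hyM := hBM y hyB
  have hy0 : 0 ≤ y := le_ultralim (Eventually.of_forall hb0) hy
  have hy1 : y ≤ 1 := ultralim_le (Eventually.of_forall hb1) hy
  refine ⟨y, hyB, hy0, hy1, fun c hc hc0 hc1 => ?_⟩
  refine le_trans ?_ (csInf_le hbd ⟨c, hc, hc0, hc1, rfl⟩)
  have hxs : star x = x := hx0.isSelfAdjoint.star_eq
  have hys : star y = y := hy0.isSelfAdjoint.star_eq
  have hm : x - y ∈ M := sub_mem hx hyM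
  have h1 : Tendsto (fun n => ψ ((x - b n) * (x - y))) U (𝓝 (ψ ((x - y) * (x - y)))) := by
    have := (h.tendsto hbn (fun n => hBM _ (hbB n)) hyM hy hm).const_sub (ψ (x * (x - y)))
    simpa only [← map_sub, ← sub_mul] using this
  have h2 : Tendsto (fun n => ‖ψ ((x - b n) * (x - y))‖ ^ 2) U (𝓝 ((n2 ψ (x - y)) ^ 2)) := by
    have h3 := (h1.norm).pow 2
    have h4 : ‖ψ ((x - y) * (x - y))‖ ^ 2 = (n2 ψ (x - y)) ^ 2 := by
      have e1 : star (x - y) = x - y := by rw [star_sub, hxs, hys]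
      have e2 := h.tr.im_star_mul hm
      unfold n2
      rw [← Complex.normSq_eq_norm_sq, Complex.normSq_apply]
      rw [e1] at e2 ⊢
      rw [e2]
      ring
    rwa [h4] at h3
  have h5 : Tendsto (fun n => r n * n2 ψ (x - y)) U (𝓝 (sInf S * n2 ψ (x - y))) :=
    (hr.mono_left hUle).mul_const _
  have h6 : n2 ψ (x - y) ^ 2 ≤ sInf S * n2 ψ (x - y) := by
    refine le_of_tendsto_of_tendsto' h2 h5 fun n => ?_
    have e1 : star (x - b n) = x - b n := by
      rw [star_sub, hxs, (hb0 n).isSelfAdjoint.star_eq]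
    have := h.tr.cs (sub_mem hx (hBM _ (hbB n))) hm
    rw [e1] at this
    rw [hbr n]
    exact this
  have h7 := h.tr.n2_nonneg hm
  rcases h7.eq_or_lt with h8 | h8
  · rw [← h8]
    refine le_csInf hne ?_
    rintro _ ⟨c, hc, -, -, rfl⟩
    exact h.tr.n2_nonneg (sub_mem hx (hBM c hc))
  · rw [sq] at h6
    exact le_of_mul_le_mul_right h6 h8

/-- `y` is the conditional expectation of `x` -/
def CEr (ψ : (H →L[ℂ] H) →ₗ[ℂ] ℂ) (B : VonNeumannAlgebra H) (x y : H →L[ℂ] H) : Prop :=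
  y ∈ B ∧ ∀ b ∈ B, ψ (y * b) = ψ (x * b)

theorem CEr.add {x x' y y' : H →L[ℂ] H} (h : CEr ψ B x y) (h' : CEr ψ B x' y') :
    CEr ψ B (x + x') (y + y') :=
  ⟨add_mem h.1 h'.1, fun b hb => by
    rw [add_mul, add_mul, map_add, map_add, h.2 b hb, h'.2 b hb]⟩

theorem CEr.smul {x y : H →L[ℂ] H} (c : ℂ) (h : CEr ψ B x y) : CEr ψ B (c • x) (c • y) :=
  ⟨smul_mem' B c h.1, fun b hb => by
    rw [smul_mul_assoc, smul_mul_assoc, map_smul, map_smul, h.2 b hb]⟩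

theorem exists_CEr_unit (h : IsNTr M ψ) (hBM : ∀ x ∈ B, x ∈ M) {x : H →L[ℂ] H} (hx : x ∈ M)
    (hx0 : 0 ≤ x) (hx1 : x ≤ 1) : ∃ y, CEr ψ B x y := by
  obtain ⟨y, hyB, hy0, hy1, hmin⟩ := h.exists_min hBM hx hx0
  have hyM := hBM y hyB
  have hxs : star x = x := hx0.isSelfAdjoint.star_eq
  have hys : star y = y := hy0.isSelfAdjoint.star_eq
  have hd : x - y ∈ M := sub_mem hx hyM
  have hds : star (x - y) = x - y := by rw [star_sub, hxs, hys]
  have hsa : ∀ b ∈ B, star b = b → ψ ((x - y) * b) = 0 := by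
    intro b hb hbs
    have hbM := hBM b hb
    have hq : ∀ t : ℝ, 0 ≤ t ^ 2 * n2 ψ b - 2 * t * (ψ ((x - y) * b)).re := by
      intro t
      have e1 : star (y + (t : ℂ) • b) = y + (t : ℂ) • b := by
        rw [star_add, star_smul, hys, hbs]
        simp
      obtain ⟨c, hc, hc0, hc1, hle⟩ := h.tr.clamp hBM hx hx0 hx1
        (add_mem hyB (smul_mem' B (t : ℂ) hb)) e1
      have h1 := (hmin c hc hc0 hc1).trans hle
      have h2 : n2 ψ (x - (y + (t : ℂ) • b)) =
          n2 ψ (x - y) - 2 * t * (ψ ((x - y) * b)).re + t ^ 2 * n2 ψ b := by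
        have e2 : x - (y + (t : ℂ) • b) = (x - y) - (t : ℂ) • b := by abel
        have e3 : star ((x - y) - (t : ℂ) • b) = (x - y) - (t : ℂ) • b := by
          rw [← e2, star_sub, e1, hxs]
        unfold n2
        rw [e2, e3, hds, hbs]
        have e5 := h.tr.tracial b hbM _ hd
        generalize x - y = d at e5 ⊢
        simp only [sub_mul, mul_sub, smul_mul_assoc, mul_smul_comm, map_sub, map_smul, e5]
        simp only [smul_eq_mul, Complex.sub_re, Complex.re_ofReal_mul]
        ring
      linarith
    have him := h.tr.im_sa hd hbM hds hbs
    have hn := h.tr.n2_nonneg hbM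
    have hre : (ψ ((x - y) * b)).re = 0 := by
      by_contra hne
      set s := (ψ ((x - y) * b)).re
      have h3 := hq (s / (n2 ψ b + 1))
      have h4 : 0 < s ^ 2 := by positivity
      have h5 : (s / (n2 ψ b + 1)) ^ 2 * n2 ψ b - 2 * (s / (n2 ψ b + 1)) * s =
          - (s ^ 2 * (n2 ψ b + 2)) / (n2 ψ b + 1) ^ 2 := by
        field_simp
        ring
      rw [h5, neg_div] at h3
      have h6 : 0 < (s ^ 2 * (n2 ψ b + 2)) / (n2 ψ b + 1) ^ 2 := by positivity
      linarith
    exact Complex.ext hre him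
  refine ⟨y, hyB, fun b hb => ?_⟩
  have h1 := hsa (b + star b) (add_mem hb (star_mem hb)) (by rw [star_add, star_star, add_comm])
  have h2 := hsa (Complex.I • (b - star b)) (smul_mem' B _ (sub_mem hb (star_mem hb))) (by
    rw [star_smul, star_sub, star_star, Complex.star_def, Complex.conj_I, neg_smul, ← smul_neg,
      neg_sub])
  rw [mul_add, map_add] at h1
  rw [mul_smul_comm, map_smul, mul_sub, map_sub, smul_eq_mul] at h2
  have h3 := (mul_eq_zero.1 h2).resolve_left Complex.I_ne_zero
  have h4 : ψ ((x - y) * b) = 0 := by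
    have := congrArg₂ (· + ·) h1 h3
    linear_combination (1 / 2 : ℂ) * this
  rw [sub_mul, map_sub] at h4
  exact (sub_eq_zero.1 h4).symm

theorem exists_CEr_sq (h : IsNTr M ψ) (hBM : ∀ x ∈ B, x ∈ M) {x : H →L[ℂ] H} (hx : x ∈ M) :
    ∃ y, CEr ψ B (star x * x) y := by
  set c : ℝ := (‖x‖ + 1)⁻¹ with hc
  have hc0 : 0 < ‖x‖ + 1 := by positivity
  have hn : ‖(c : ℂ) • x‖ ≤ 1 := by
    rw [norm_smul, Complex.norm_real, Real.norm_eq_abs, abs_of_pos (by positivity), hc,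
      inv_mul_le_iff₀ hc0]
    linarith
  have h1 := star_mul_le_one_of_norm hn
  obtain ⟨y, hy⟩ := exists_CEr_unit h hBM
    (mul_mem (star_mem (smul_mem' M (c : ℂ) hx)) (smul_mem' M (c : ℂ) hx))
    (star_mul_self_nonneg _) h1
  have h2 := hy.smul (((‖x‖ + 1) ^ 2 : ℝ) : ℂ)
  refine ⟨(((‖x‖ + 1) ^ 2 : ℝ) : ℂ) • y, ?_⟩
  convert h2 using 1
  rw [star_smul, smul_mul_assoc, mul_smul_comm, smul_smul, smul_smul]
  have : (((‖x‖ + 1) ^ 2 : ℝ) : ℂ) * (star (c : ℂ) * (c : ℂ)) = 1 := by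
    have e : star (c : ℂ) = (c : ℂ) := Complex.conj_ofReal c
    rw [e, ← Complex.ofReal_mul, ← Complex.ofReal_mul, hc]
    norm_cast
    field_simp
  rw [mul_assoc, this, one_smul]

theorem exists_CEr (h : IsNTr M ψ) (hBM : ∀ x ∈ B, x ∈ M) {x : H →L[ℂ] H} (hx : x ∈ M) :
    ∃ y, CEr ψ B x y := by
  obtain ⟨y1, h1⟩ := exists_CEr_sq h hBM (add_mem hx (one_mem M))
  obtain ⟨y2, h2⟩ := exists_CEr_sq h hBM (sub_mem hx (one_mem M))
  obtain ⟨y3, h3⟩ := exists_CEr_sq h hBM (add_mem hx (smul_mem' M Complex.I (one_mem M)))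
  obtain ⟨y4, h4⟩ := exists_CEr_sq h hBM (sub_mem hx (smul_mem' M Complex.I (one_mem M)))
  have h5 := (((h1.smul (1 / 4)).add (h2.smul (-1 / 4))).add (h3.smul (Complex.I / 4))).add
    (h4.smul (-Complex.I / 4))
  refine ⟨(1 / 4 : ℂ) • y1 + (-1 / 4 : ℂ) • y2 + (Complex.I / 4) • y3 + (-Complex.I / 4) • y4, ?_⟩
  · convert h5 using 1
    simp only [star_add, star_sub, star_one, star_smul, add_mul, mul_add, sub_mul, mul_sub,
      one_mul, mul_one, smul_mul_assoc, mul_smul_comm, smul_smul, Complex.star_def,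
      Complex.conj_I]
    match_scalars <;> ring_nf <;> simp <;> norm_num

theorem CEr.unique (h : IsTr M ψ) (hBM : ∀ x ∈ B, x ∈ M) {x y y' : H →L[ℂ] H}
    (h1 : CEr ψ B x y) (h2 : CEr ψ B x y') : y = y' := by
  have hm := sub_mem h1.1 h2.1
  refine sub_eq_zero.1 (h.eq_zero_of_orth (hBM _ hm) ?_)
  rw [sub_mul, map_sub, h1.2 _ (star_mem hm), h2.2 _ (star_mem hm), sub_self]

theorem CEr.mul_left (h : IsTr M ψ) (hBM : ∀ x ∈ B, x ∈ M) {x y a : H →L[ℂ] H} (hx : x ∈ M)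
    (h1 : CEr ψ B x y) (ha : a ∈ B) : CEr ψ B (a * x) (a * y) := by
  refine ⟨mul_mem ha h1.1, fun b hb => ?_⟩
  have haM := hBM a ha
  have hbM := hBM b hb
  rw [mul_assoc, h.tracial a haM _ (mul_mem (hBM y h1.1) hbM), mul_assoc,
    h1.2 _ (mul_mem hb ha), mul_assoc, h.tracial a haM _ (mul_mem hx hbM), mul_assoc]

theorem CEr.mul_right {x y a : H →L[ℂ] H}
    (h1 : CEr ψ B x y) (ha : a ∈ B) : CEr ψ B (x * a) (y * a) := by
  refine ⟨mul_mem h1.1 ha, fun b hb => ?_⟩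
  rw [mul_assoc, mul_assoc, h1.2 _ (mul_mem ha hb)]

theorem CEr.comm (h : IsTr M ψ) (hBM : ∀ x ∈ B, x ∈ M) {x y a : H →L[ℂ] H} (hx : x ∈ M)
    (h1 : CEr ψ B x y) (ha : a ∈ B) (hax : a * x = x * a) : a * y = y * a := by
  refine CEr.unique h hBM (h1.mul_left h hBM hx ha) ?_
  rw [hax]
  exact h1.mul_right ha

end CE

end TG
namespace TG
open Filter Topology ContinuousLinearMap

section Main

variable {H : Type} [NormedAddCommGroup H] [InnerProductSpace ℂ H] [CompleteSpace H]

/-- the commutant of a star-closed set as a von Neumann algebra -/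
theorem exists_vna (S : Set (H →L[ℂ] H)) (hS : ∀ x ∈ S, star x ∈ S) :
    ∃ W : VonNeumannAlgebra H, ∀ x, x ∈ W ↔ ∀ t ∈ S, t * x = x * t := by
  have hc : ((StarSubalgebra.centralizer ℂ S : StarSubalgebra ℂ (H →L[ℂ] H)) :
      Set (H →L[ℂ] H)) = S.centralizer := by
    ext x
    rw [SetLike.mem_coe, StarSubalgebra.mem_centralizer_iff]
    constructor
    · intro h t ht
      exact (h t ht).1
    · intro h t ht
      exact ⟨h t ht, h _ (hS t ht)⟩
  refine ⟨{ StarSubalgebra.centralizer ℂ S with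
    centralizer_centralizer' := ?_ }, ?_⟩
  · change Set.centralizer (Set.centralizer
      ((StarSubalgebra.centralizer ℂ S : StarSubalgebra ℂ (H →L[ℂ] H)) : Set (H →L[ℂ] H))) =
      ((StarSubalgebra.centralizer ℂ S : StarSubalgebra ℂ (H →L[ℂ] H)) : Set (H →L[ℂ] H))
    rw [hc, Set.centralizer_centralizer_centralizer]
  · intro x
    change x ∈ ((StarSubalgebra.centralizer ℂ S : StarSubalgebra ℂ (H →L[ℂ] H)) :
      Set (H →L[ℂ] H)) ↔ _
    rw [hc]
    rfl

variable {M P : VonNeumannAlgebra H} {ψ : (H →L[ℂ] H) →ₗ[ℂ] ℂ}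

theorem factor_scalar (h : IsNTr M ψ) (hPM : ∀ x ∈ P, x ∈ M)
    (hfac : CD.IsFactorSet (P : Set (H →L[ℂ] H))) {c : H →L[ℂ] H} (hc : c ∈ M)
    (hcP : ∀ p ∈ P, p * c = c * p) : ∃ z : ℂ, ∀ p ∈ P, ψ (c * p) = z * ψ p := by
  obtain ⟨y, hy⟩ := exists_CEr h hPM hc
  obtain ⟨z, hz⟩ := hfac y hy.1 (fun p hp => (hy.comm h.tr hPM hc hp (hcP p hp)).symm)
  refine ⟨z, fun p hp => ?_⟩
  rw [← hy.2 p hp, hz, smul_mul_assoc, one_mul, map_smul, smul_eq_mul]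

theorem IsTr.one_pos (h : IsTr M ψ) (hne : (1 : H →L[ℂ] H) ≠ 0) : 0 < (ψ 1).re := by
  have h1 := h.n2_nonneg (one_mem M)
  rcases h1.eq_or_lt with h2 | h2
  · exact absurd (h.n2_eq_zero (one_mem M) h2.symm.le) hne
  · simpa [n2] using h2

/-- elements implementing an automorphism of a factor are multiples of unitaries -/
theorem implement (h : IsTr M ψ) (hPM : ∀ x ∈ P, x ∈ M) (hne : (1 : H →L[ℂ] H) ≠ 0)
    (hfac : CD.IsFactorSet (P : Set (H →L[ℂ] H))) (α : (H →L[ℂ] H) → (H →L[ℂ] H))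
    (hαP : ∀ p ∈ P, α p ∈ P) (hαs : ∀ p, star (α p) = α (star p))
    (hαsurj : ∀ p ∈ P, ∃ q ∈ P, α q = p) {w : H →L[ℂ] H} (hw : w ∈ P)
    (hpw : ∀ p ∈ P, p * w = w * α p) (hw0 : w ≠ 0) :
    ∃ v, CD.IsUnitaryIn (P : Set (H →L[ℂ] H)) v ∧ ∀ p ∈ P, α p = v * p * star v := by
  have hws : ∀ p ∈ P, star w * p = α p * star w := by
    intro p hp
    have h1 := congrArg star (hpw (star p) (star_mem hp))
    rw [star_mul, star_star, star_mul, hαs, star_star] at h1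
    exact h1
  obtain ⟨z, hz⟩ := hfac (w * star w) (mul_mem hw (star_mem hw)) (fun p hp => by
    rw [mul_assoc, hws p hp, ← mul_assoc, ← hpw p hp, mul_assoc])
  obtain ⟨z', hz'⟩ := hfac (star w * w) (mul_mem (star_mem hw) hw) (fun p hp => by
    obtain ⟨q, hq, rfl⟩ := hαsurj p hp
    rw [mul_assoc, ← hpw q hq, ← mul_assoc, hws q hq, mul_assoc])
  have hzz : z = z' := by
    have h1 : z • w = z' • w := by
      have e1 : (w * star w) * w = w * (star w * w) := mul_assoc _ _ _
      rw [hz, hz', smul_mul_assoc, mul_smul_comm, one_mul, mul_one] at e1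
      exact e1
    exact smul_left_injective ℂ hw0 h1
  subst hzz
  have hψ1 := h.one_pos hne
  have him1 : (ψ 1).im = 0 := h.im_pos (one_mem M) zero_le_one
  have hpos := h.n2_nonneg (hPM w hw)
  have him := h.im_star_mul (hPM w hw)
  have hzim : z.im = 0 := by
    rw [hz', map_smul, smul_eq_mul, Complex.mul_im, him1, mul_zero, zero_add] at him
    exact (mul_eq_zero.1 him).resolve_right hψ1.ne'
  have hzne : z ≠ 0 := by
    rintro rfl
    rw [zero_smul] at hz'
    exact hw0 (CStarRing.star_mul_self_eq_zero_iff w |>.1 hz')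
  have hzre : 0 < z.re := by
    unfold n2 at hpos
    rw [hz', map_smul, smul_eq_mul, Complex.mul_re, him1, mul_zero, sub_zero] at hpos
    have h2 : 0 ≤ z.re := nonneg_of_mul_nonneg_left hpos hψ1
    rcases h2.eq_or_lt with h3 | h3
    · exact absurd (Complex.ext h3.symm hzim) hzne
    · exact h3
  set c : ℂ := (((Real.sqrt z.re)⁻¹ : ℝ) : ℂ) with hc
  have hcs : star c = c := Complex.conj_ofReal _
  have hccz : c * c * z = 1 := by
    have e1 : z = ((z.re : ℝ) : ℂ) := Complex.ext (by simp) (by simp [hzim])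
    rw [e1, hc, ← Complex.ofReal_mul, ← Complex.ofReal_mul, ← mul_inv, Real.mul_self_sqrt hzre.le,
      inv_mul_cancel₀ hzre.ne', Complex.ofReal_one]
  refine ⟨c • star w, ⟨smul_mem' P c (star_mem hw), ?_, ?_⟩, ?_⟩
  · rw [star_smul, star_star, smul_mul_assoc, mul_smul_comm, smul_smul, hz, smul_smul, hcs, hccz,
      one_smul]
  · rw [star_smul, star_star, smul_mul_assoc, mul_smul_comm, smul_smul, hz', smul_smul, hcs, hccz,
      one_smul]
  · intro p hp
    rw [star_smul, star_star, smul_mul_assoc, smul_mul_assoc, mul_smul_comm, smul_smul, hws p hp,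
      mul_assoc, hz', mul_smul_comm, smul_smul, mul_one, hcs, hccz, one_smul]

end Main

end TG
open CD in
/-- Theorem `twistedGe`. Let `P` be a II₁ factor and `Q` a finite
separable von Neumann algebra, both with trace-preserving `Γ`-actions, where `Γ ↷ P`
is outer. Then every intermediate von Neumann subalgebra
`P ⋊ Γ ⊆ N ⊆ (P ⊗̄ Q) ⋊ Γ` is of the form `(P ⊗̄ Q₀) ⋊ Γ` for a von Neumann
subalgebra `Q₀ ⊆ Q`. The tensor product `P ⊗̄ Q` is modelled, inside the coefficient
algebra `X.A` of the crossed product `X`, by commuting subalgebras `P, Q` which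
generate `X.A` and are independent with respect to the trace; `P ⊗̄ Q₀` is then the
von Neumann algebra generated by `P ∪ Q₀`. -/
theorem stmt12_twisted_ge
    (Γ : Type) [Group Γ] [Countable Γ]
    (H : Type) [NormedAddCommGroup H] [InnerProductSpace ℂ H] [CompleteSpace H]
    -- the crossed product `(P ⊗̄ Q) ⋊ Γ` of the diagonal action, with `X.A = P ⊗̄ Q`
    (X : CrossedProduct Γ H)
    (P Q : VonNeumannAlgebra H)
    (hP : (P : Set (H →L[ℂ] H)) ⊆ (X.A : Set (H →L[ℂ] H)))
    (hQ : (Q : Set (H →L[ℂ] H)) ⊆ (X.A : Set (H →L[ℂ] H)))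
    -- `P` and `Q` commute, generate `X.A`, and are trace-independent: `X.A = P ⊗̄ Q`
    (hcomm : ∀ p ∈ P, ∀ q ∈ Q, p * q = q * p)
    (hgen : vnGen ((P : Set (H →L[ℂ] H)) ∪ (Q : Set (H →L[ℂ] H))) = (X.A : Set (H →L[ℂ] H)))
    (hindep : ∀ p ∈ P, ∀ q ∈ Q, X.tr.τ (p * q) = X.tr.τ p * X.tr.τ q)
    -- the diagonal action preserves each tensor factor
    (hPinv : InvariantUnder X (P : Set (H →L[ℂ] H)))
    (hQinv : InvariantUnder X (Q : Set (H →L[ℂ] H)))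
    -- `P` is a II₁ factor and `Γ ↷ P` is outer
    (hPfac : IsII1On X.tr (P : Set (H →L[ℂ] H)))
    (houter : IsOuterOn X (P : Set (H →L[ℂ] H)))
    -- `Q` is separable
    (hsep : IsSeparableSet X.tr (Q : Set (H →L[ℂ] H)))
    -- an intermediate von Neumann subalgebra `P ⋊ Γ ⊆ N ⊆ (P ⊗̄ Q) ⋊ Γ`
    (N : VonNeumannAlgebra H)
    (hN₁ : midCP X (P : Set (H →L[ℂ] H)) ⊆ (N : Set (H →L[ℂ] H)))
    (hN₂ : (N : Set (H →L[ℂ] H)) ⊆ (X.M : Set (H →L[ℂ] H))) :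
    ∃ Q₀ : VonNeumannAlgebra H,
      (Q₀ : Set (H →L[ℂ] H)) ⊆ (Q : Set (H →L[ℂ] H)) ∧
      InvariantUnder X (Q₀ : Set (H →L[ℂ] H)) ∧
      (N : Set (H →L[ℂ] H)) =
        midCP X (vnGen ((P : Set (H →L[ℂ] H)) ∪ (Q₀ : Set (H →L[ℂ] H)))) := by
  have hPA : ∀ x ∈ P, x ∈ X.A := fun x hx => hP hx
  have hQA : ∀ x ∈ Q, x ∈ X.A := fun x hx => hQ hx
  have hAM : ∀ x ∈ X.A, x ∈ X.M := fun x hx => X.A_sub hx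
  have hPM : ∀ x ∈ P, x ∈ X.M := fun x hx => hAM x (hPA x hx)
  have hQM : ∀ x ∈ Q, x ∈ X.M := fun x hx => hAM x (hQA x hx)
  have hNM : ∀ x ∈ N, x ∈ X.M := fun x hx => hN₂ hx
  have hfac := hPfac.1
  have hτ := TG.IsTr.of_traceOn X.tr
  have hτ1 : (X.tr.τ 1).re = 1 := by rw [X.tr.unital]; rfl
  have hne : (1 : H →L[ℂ] H) ≠ 0 := by
    intro h0
    rw [h0, map_zero] at hτ1
    simp at hτ1
  obtain ⟨k, hkM, hkc, hψ⟩ := TG.exists_density hτ hτ1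
  set ψ := X.tr.τ ∘ₗ LinearMap.mulLeft ℂ k with hψdef
  have hψa : ∀ x, ψ x = X.tr.τ (k * x) := fun x => rfl
  have htr := hψ.tr
  have hψ1 : ψ 1 ≠ 0 := by
    intro h0
    have := htr.one_pos hne
    rw [h0] at this
    simp at this
  -- density of products
  have hdens : ∀ d ∈ X.A, (∀ p ∈ P, ∀ q ∈ Q, ψ (d * (p * q)) = 0) → d = 0 := by
    intro d hd h0
    refine htr.eq_zero_of_orth (hAM d hd) ?_
    refine hψ.density {x | ∃ p ∈ P, ∃ q ∈ Q, x = p * q} ?_ ?_ ?_ ?_ (hAM _ (star_mem hd))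
      (hAM d hd) ?_ ?_
    · rintro _ ⟨p, hp, q, hq, rfl⟩
      exact mul_mem (hPM p hp) (hQM q hq)
    · exact ⟨1, one_mem P, 1, one_mem Q, (mul_one _).symm⟩
    · rintro _ ⟨p, hp, q, hq, rfl⟩ _ ⟨p', hp', q', hq', rfl⟩
      refine ⟨p * p', mul_mem hp hp', q * q', mul_mem hq hq', ?_⟩
      rw [mul_assoc, ← mul_assoc q, ← hcomm p' hp' q hq]
      simp only [mul_assoc]
    · rintro _ ⟨p, hp, q, hq, rfl⟩
      refine ⟨star p, star_mem hp, star q, star_mem hq, ?_⟩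
      rw [star_mul, hcomm _ (star_mem hp) _ (star_mem hq)]
    · intro t ht
      have h1 : star d ∈ vnGen ((P : Set (H →L[ℂ] H)) ∪ (Q : Set (H →L[ℂ] H))) := by
        rw [hgen]; exact star_mem hd
      have h2 : t ∈ Set.centralizer ((P : Set (H →L[ℂ] H)) ∪ (Q : Set (H →L[ℂ] H))) := by
        rintro x (hx | hx)
        · have := ht (x * 1) ⟨x, hx, 1, one_mem Q, rfl⟩
          simpa using this
        · have := ht (1 * x) ⟨1, one_mem P, x, hx, rfl⟩
          simpa using this
      exact (h1 t h2).symm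
    · rintro _ ⟨p, hp, q, hq, rfl⟩
      exact h0 p hp q hq
  -- relative commutant in `A`
  have hrelA : ∀ a ∈ X.A, (∀ p ∈ P, p * a = a * p) → a ∈ Q := by
    intro a ha hap
    obtain ⟨y, hy⟩ := TG.exists_CEr hψ hQM (hAM a ha)
    have hyA := hQA y hy.1
    have hdA : a - y ∈ X.A := sub_mem ha hyA
    have hdM := hAM _ hdA
    have hdP : ∀ p ∈ P, p * (a - y) = (a - y) * p := by
      intro p hp
      rw [mul_sub, sub_mul, hap p hp, hcomm p hp y hy.1]
    have hdq : ∀ q ∈ Q, ψ ((a - y) * q) = 0 := by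
      intro q hq
      rw [sub_mul, map_sub, hy.2 q hq, sub_self]
    have hd0 : a - y = 0 := by
      refine hdens _ hdA fun p hp q hq => ?_
      have hqM := hQM q hq
      have hpM := hPM p hp
      obtain ⟨z, hz⟩ := TG.factor_scalar hψ hPM hfac (mul_mem hqM hdM) (fun p hp => by
        rw [← mul_assoc, hcomm p hp q hq, mul_assoc, hdP p hp, mul_assoc])
      have h1 := hz 1 (one_mem P)
      rw [mul_one, htr.tracial q hqM _ hdM, hdq q hq] at h1
      have hz0 : z = 0 := (mul_eq_zero.1 h1.symm).resolve_right hψ1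
      have h2 := hz p hp
      rw [hz0, zero_mul, mul_assoc, htr.tracial q hqM _ (mul_mem hdM hpM), mul_assoc] at h2
      exact h2
    rw [sub_eq_zero.1 hd0]
    exact hy.1
  have huu : ∀ γ, star (X.u γ) * X.u γ = 1 := by
    intro γ
    rw [X.u_star, X.u_mul, inv_mul_cancel, X.u_one]
  have huu' : ∀ γ, X.u γ * star (X.u γ) = 1 := by
    intro γ
    rw [X.u_star, X.u_mul, mul_inv_cancel, X.u_one]
  -- outerness
  have hout : ∀ γ : Γ, γ ≠ 1 → ∀ b ∈ X.A, (∀ p ∈ P, p * b = b * X.σ γ p) → b = 0 := by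
    intro γ hγ b hb hbp
    refine hdens b hb fun p hp q hq => ?_
    have hbq : b * q ∈ X.M := mul_mem (hAM b hb) (hQM q hq)
    obtain ⟨w, hw⟩ := TG.exists_CEr hψ hPM hbq
    have hσP : ∀ p ∈ P, X.σ γ p ∈ P := fun p hp => hPinv γ p hp
    have hpw : ∀ p ∈ P, p * w = w * X.σ γ p := by
      intro p hp
      refine TG.CEr.unique htr hPM (hw.mul_left htr hPM hbq hp) ?_
      have := hw.mul_right (hσP p hp)
      rwa [mul_assoc, ← hcomm _ (hσP p hp) q hq, ← mul_assoc, ← hbp p hp, mul_assoc] at this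
    have hw0 : w = 0 := by
      by_contra hw0
      refine houter γ hγ (TG.implement htr hPM hne hfac (X.σ γ) hσP ?_ ?_ hw.1 hpw hw0)
      · intro p
        unfold CrossedProduct.σ
        rw [star_mul, star_mul, star_star, mul_assoc]
      · intro p hp
        refine ⟨X.σ γ⁻¹ p, hPinv γ⁻¹ p hp, ?_⟩
        unfold CrossedProduct.σ
        rw [← X.u_star γ, star_star, show X.u γ * (star (X.u γ) * p * X.u γ) * star (X.u γ) =
          (X.u γ * star (X.u γ)) * p * (X.u γ * star (X.u γ)) by simp only [mul_assoc], huu',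
          one_mul, mul_one]
    have h1 := hw.2 p hp
    rw [hw0, zero_mul, map_zero, mul_assoc, ← hcomm p hp q hq] at h1
    exact h1.symm
  -- properties of the expectation onto `A`
  have hEl : ∀ a ∈ X.A, ∀ x ∈ X.M, X.EA.E (a * x) = a * X.EA.E x := by
    intro a ha x hx
    have := X.EA.bimod a ha 1 (one_mem X.A) x hx
    simpa using this
  have hEr : ∀ a ∈ X.A, ∀ x ∈ X.M, X.EA.E (x * a) = X.EA.E x * a := by
    intro a ha x hx
    have := X.EA.bimod 1 (one_mem X.A) a ha x hx
    simpa using this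
  have hEmem : ∀ x ∈ X.M, X.EA.E x ∈ X.A := fun x hx => X.EA.mem x hx
  have hE1 : X.EA.E 1 = 1 := X.EA.fix 1 (one_mem X.A)
  have husM : ∀ γ, star (X.u γ) ∈ X.M := fun γ => star_mem (X.u_mem γ)
  have hEus : ∀ γ : Γ, γ ≠ 1 → X.EA.E (star (X.u γ)) = 0 := by
    intro γ hγ
    rw [X.u_star]
    exact X.EA_u _ (inv_ne_one.2 hγ)
  -- relative commutant in `M`
  have hrelMA : ∀ x ∈ X.M, (∀ p ∈ P, p * x = x * p) → x ∈ X.A := by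
    intro x hx hxp
    have hd : x - X.EA.E x = 0 := by
      refine X.fourier_sep _ (sub_mem hx (hAM _ (hEmem x hx))) fun γ => ?_
      rw [sub_mul, map_sub, hEl _ (hEmem x hx) _ (husM γ)]
      by_cases hγ : γ = 1
      · subst hγ
        rw [X.u_one, star_one, mul_one, hE1, mul_one, sub_self]
      · rw [hEus γ hγ, mul_zero, sub_zero]
        have hxu := mul_mem hx (husM γ)
        refine hout γ hγ _ (hEmem _ hxu) fun p hp => ?_
        have hσ : X.σ γ p ∈ X.A := hPA _ (hPinv γ p hp)
        rw [← hEl p (hPA p hp) _ hxu, ← hEr _ hσ _ hxu]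
        congr 1
        unfold CrossedProduct.σ
        rw [← mul_assoc, hxp p hp, show x * star (X.u γ) * (X.u γ * p * star (X.u γ)) =
          x * (star (X.u γ) * X.u γ) * p * star (X.u γ) by simp only [mul_assoc], huu, mul_one]
    rw [sub_eq_zero.1 hd]
    exact hEmem x hx
  have hrelM : ∀ x ∈ X.M, (∀ p ∈ P, p * x = x * p) → x ∈ Q := fun x hx hxp =>
    hrelA x (hrelMA x hx hxp) hxp
  have hkA : k ∈ X.A := hrelMA k hkM fun p hp => (hkc p (hPM p hp)).symm
  have hψE : ∀ x ∈ X.M, ∀ a ∈ X.A, ψ (X.EA.E x * a) = ψ (x * a) := by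
    intro x hx a ha
    rw [← hEr a ha x hx, hψa, hψa, ← hEl k hkA _ (mul_mem hx (hAM a ha)),
      X.EA.trace_eq _ (mul_mem hkM (mul_mem hx (hAM a ha)))]
  -- the subalgebra
  have huN : ∀ γ, X.u γ ∈ N := by
    intro γ
    refine hN₁ ⟨X.u_mem γ, fun δ => ?_⟩
    rw [X.u_star, X.u_mul]
    by_cases h : γ * δ⁻¹ = 1
    · rw [h, X.u_one, hE1]; exact one_mem P
    · rw [X.EA_u _ h]; exact zero_mem P
  have hPN : ∀ p ∈ P, p ∈ N := by
    intro p hp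
    refine hN₁ ⟨hPM p hp, fun δ => ?_⟩
    rw [hEl p (hPA p hp) _ (husM δ)]
    by_cases h : δ = 1
    · rw [h, X.u_one, star_one, hE1, mul_one]; exact hp
    · rw [hEus δ h, mul_zero]; exact zero_mem P
  obtain ⟨Q₀, hQ₀⟩ := TG.exists_vna
    ((N.commutant : Set (H →L[ℂ] H)) ∪ (Q.commutant : Set (H →L[ℂ] H))) (by
      rintro x (hx | hx)
      · exact Or.inl (star_mem (S := VonNeumannAlgebra H) hx)
      · exact Or.inr (star_mem (S := VonNeumannAlgebra H) hx))
  have hQ₀iff : ∀ x, x ∈ Q₀ ↔ x ∈ N ∧ x ∈ Q := by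
    intro x
    rw [hQ₀]
    constructor
    · intro h
      exact ⟨TG.mem_of_comm N fun t ht => h t (Or.inl ht),
        TG.mem_of_comm Q fun t ht => h t (Or.inr ht)⟩
    · rintro ⟨h1, h2⟩ t (ht | ht)
      · exact (TG.comm_of_mem N h1 ht).symm
      · exact (TG.comm_of_mem Q h2 ht).symm
  obtain ⟨R, hR⟩ := TG.exists_vna
    (Set.centralizer ((P : Set (H →L[ℂ] H)) ∪ (Q₀ : Set (H →L[ℂ] H)))) (by
      intro x hx t ht
      have hst : star t ∈ (P : Set (H →L[ℂ] H)) ∪ (Q₀ : Set (H →L[ℂ] H)) := by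
        rcases ht with ht | ht
        · exact Or.inl (star_mem (S := VonNeumannAlgebra H) ht)
        · exact Or.inr (star_mem (S := VonNeumannAlgebra H) ht)
      have := congrArg star (hx (star t) hst)
      rw [star_mul, star_mul, star_star] at this
      exact this.symm)
  have hRset : (R : Set (H →L[ℂ] H)) =
      vnGen ((P : Set (H →L[ℂ] H)) ∪ (Q₀ : Set (H →L[ℂ] H))) := by
    ext x
    exact hR x
  have hRsub : ∀ W : VonNeumannAlgebra H, (∀ p ∈ P, p ∈ W) → (∀ q ∈ Q₀, q ∈ W) →
      ∀ r ∈ R, r ∈ W := by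
    intro W h1 h2 r hr
    refine TG.mem_of_comm W fun t ht => (hR r).1 hr t ?_
    rintro x (hx | hx)
    · exact TG.comm_of_mem W (h1 x hx) ht
    · exact TG.comm_of_mem W (h2 x hx) ht
  have hRN : ∀ r ∈ R, r ∈ N := hRsub N hPN fun q hq => ((hQ₀iff q).1 hq).1
  have hRA : ∀ r ∈ R, r ∈ X.A := hRsub X.A hPA fun q hq => hQA q ((hQ₀iff q).1 hq).2
  have hRM : ∀ r ∈ R, r ∈ X.M := fun r hr => hAM r (hRA r hr)
  have hPR : ∀ p ∈ P, p ∈ R := fun p hp => (hR p).2 fun t ht => (ht p (Or.inl hp)).symm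
  have hQR : ∀ q ∈ Q₀, q ∈ R := fun q hq => (hR q).2 fun t ht => (ht q (Or.inr hq)).symm
  -- expectations of elements of `Q`
  have hEN : ∀ q ∈ Q, ∃ q₀ ∈ Q₀, ∀ n ∈ N, ψ (q₀ * n) = ψ (q * n) := by
    intro q hq
    obtain ⟨y, hy⟩ := TG.exists_CEr hψ hNM (hQM q hq)
    refine ⟨y, (hQ₀iff y).2 ⟨hy.1, hrelM y (hNM y hy.1) fun p hp => ?_⟩, hy.2⟩
    exact hy.comm htr hNM (hQM q hq) (hPN p hp) (hcomm p hp q hq)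
  have hcoef : ∀ x ∈ N, X.EA.E x ∈ R := by
    intro x hx
    have hxM := hNM x hx
    have haA := hEmem x hxM
    obtain ⟨y, hy⟩ := TG.exists_CEr hψ hRM (hAM _ haA)
    have hyA := hRA y hy.1
    have hd : X.EA.E x - y = 0 := by
      refine hdens _ (sub_mem haA hyA) fun p hp q hq => ?_
      obtain ⟨q₀, hq₀, hqq⟩ := hEN q hq
      have hq₀M := hRM q₀ (hQR q₀ hq₀)
      have hqM := hQM q hq
      have hpM := hPM p hp
      have hyM := hAM y hyA
      have key : ∀ n ∈ N, ψ (n * (p * q)) = ψ (n * (p * q₀)) := by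
        intro n hn
        have hnp := mul_mem hn (hPN p hp)
        rw [← mul_assoc, ← mul_assoc, htr.tracial _ (hNM _ hnp) q hqM,
          htr.tracial _ (hNM _ hnp) q₀ hq₀M, hqq _ hnp]
      rw [sub_mul, map_sub, hψE x hxM _ (mul_mem (hPA p hp) (hQA q hq)), key x hx,
        ← hψE x hxM _ (mul_mem (hPA p hp) (hRA q₀ (hQR q₀ hq₀))), key y (hRN y hy.1),
        hy.2 _ (mul_mem (hPR p hp) (hQR q₀ hq₀)), sub_self]
    rw [sub_eq_zero.1 hd]
    exact hy.1
  refine ⟨Q₀, fun q hq => ((hQ₀iff q).1 hq).2, ?_, ?_⟩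
  · intro γ q hq
    have hq' := (hQ₀iff q).1 hq
    refine (hQ₀iff _).2 ⟨?_, hQinv γ q hq'.2⟩
    exact mul_mem (mul_mem (huN γ) hq'.1) (star_mem (huN γ))
  · rw [← hRset]
    ext x
    constructor
    · intro hx
      exact ⟨hNM x hx, fun γ => hcoef _ (mul_mem (S := VonNeumannAlgebra H) hx (star_mem (huN γ)))⟩
    · rintro ⟨hxM, hxR⟩
      obtain ⟨y, hy⟩ := TG.exists_CEr hψ hNM hxM
      have hyM := hNM y hy.1
      have hd : x - y = 0 := by
        refine X.fourier_sep _ (sub_mem hxM hyM) fun γ => ?_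
        have hduM := mul_mem (sub_mem hxM hyM) (husM γ)
        have hrR : X.EA.E ((x - y) * star (X.u γ)) ∈ R := by
          rw [sub_mul, map_sub]
          exact sub_mem (show _ ∈ R from hxR γ) (hcoef _ (mul_mem hy.1 (star_mem (huN γ))))
        refine htr.eq_zero_of_orth (hRM _ hrR) ?_
        rw [hψE _ hduM _ (hRA _ (star_mem hrR)), mul_assoc, sub_mul, map_sub,
          hy.2 _ (mul_mem (star_mem (huN γ)) (hRN _ (star_mem hrR))), sub_self]
      rw [sub_eq_zero.1 hd]
      exact hy.1
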